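/- arXiv:1612.09167 — 11 statements merged into one kernel-verified Lean document; each statement's English description precedes it below -/
import Mathlib

section
/- Let c be a real number with 0 < 2c < β. Then the function z ↦ (z^2 - 2cz)/S(z) attains its supremum over (0,β) at some point z_c ∈ (2c, β), and every point of (0,β) at which this supremum is attained lies in (2c, β). -/
open Filter

/-- Let `S` be a continuous strictly increasing positive scale function on `(0, β)`
(`β ≤ ∞`, modelled as `β : EReal`) with `S(0+) = 0` and `z²/S(z) → 0` as `z → β⁻`.
For `0 < 2c < β`, the function `z ↦ (z² - 2cz)/S(z)` attains its supremum over `(0, β)`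
at some point of `(2c, β)`, and every maximizer lies in `(2c, β)`. -/
theorem exists_maximizer_in_Ioo_two_c_beta
    (β : EReal) (hβ : 0 < β) (S : ℝ → ℝ)
    (hScont : ContinuousOn S {z : ℝ | 0 < z ∧ (z : EReal) < β})
    (hSmono : StrictMonoOn S {z : ℝ | 0 < z ∧ (z : EReal) < β})
    (hSpos : ∀ z : ℝ, 0 < z → (z : EReal) < β → 0 < S z)
    (hS0 : Tendsto S (nhdsWithin 0 (Set.Ioi 0)) (nhds 0))
    (hSβ : Tendsto (fun z : ℝ => z ^ 2 / S z)
      (comap (fun z : ℝ => (z : EReal)) (nhdsWithin β (Set.Iio β))) (nhds 0))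
    (c : ℝ) (hc : 0 < c) (hcβ : ((2 * c : ℝ) : EReal) < β) :
    ∃ zc : ℝ, 0 < zc ∧ (zc : EReal) < β ∧ 2 * c < zc ∧
      (∀ z : ℝ, 0 < z → (z : EReal) < β →
        (z ^ 2 - 2 * c * z) / S z ≤ (zc ^ 2 - 2 * c * zc) / S zc) ∧
      (∀ z : ℝ, 0 < z → (z : EReal) < β →
        (∀ w : ℝ, 0 < w → (w : EReal) < β →
          (w ^ 2 - 2 * c * w) / S w ≤ (z ^ 2 - 2 * c * z) / S z) → 2 * c < z) := by
  obtain ⟨z₀, hz₀, hz₀β⟩ := EReal.lt_iff_exists_real_btwn.1 hcβ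
  have hz₀' : 2 * c < z₀ := EReal.coe_lt_coe_iff.1 hz₀
  have hm : 0 < (z₀ ^ 2 - 2 * c * z₀) / S z₀ := by
    refine div_pos ?_ (hSpos z₀ (by linarith) hz₀β)
    nlinarith
  obtain ⟨t, ht, htsub⟩ := mem_comap.1 (hSβ.eventually_lt_const hm)
  obtain ⟨l, hl, hlsub⟩ := (mem_nhdsLT_iff_exists_Ioo_subset' hβ).1 ht
  obtain ⟨b, hb, hbβ⟩ := EReal.lt_iff_exists_real_btwn.1 (max_lt hl hz₀β)
  have hz₀b : z₀ < b := EReal.coe_lt_coe_iff.1 ((le_max_right _ _).trans_lt hb)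
  have hsub : Set.Icc (2 * c) b ⊆ {z : ℝ | 0 < z ∧ (z : EReal) < β} := fun z hz =>
    ⟨by linarith [hz.1], (EReal.coe_le_coe_iff.2 hz.2).trans_lt hbβ⟩
  have hcont : ContinuousOn (fun z => (z ^ 2 - 2 * c * z) / S z) (Set.Icc (2 * c) b) :=
    ContinuousOn.div (by fun_prop) (hScont.mono hsub)
      fun z hz => (hSpos z (hsub hz).1 (hsub hz).2).ne'
  obtain ⟨zc, hzc, hmax⟩ := isCompact_Icc.exists_isMaxOn ⟨z₀, hz₀'.le, hz₀b.le⟩ hcont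
  have hzcm : (z₀ ^ 2 - 2 * c * z₀) / S z₀ ≤ (zc ^ 2 - 2 * c * zc) / S zc :=
    hmax (show z₀ ∈ Set.Icc (2 * c) b from ⟨hz₀'.le, hz₀b.le⟩)
  have hnonpos : ∀ z : ℝ, 0 < z → (z : EReal) < β → z ≤ 2 * c →
      (z ^ 2 - 2 * c * z) / S z ≤ 0 := fun z hz hzβ hzc =>
    div_nonpos_of_nonpos_of_nonneg (by nlinarith) (hSpos z hz hzβ).le
  have hgt : ∀ z : ℝ, 0 < z → (z : EReal) < β →
      (z₀ ^ 2 - 2 * c * z₀) / S z₀ ≤ (z ^ 2 - 2 * c * z) / S z → 2 * c < z := by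
    intro z hz hzβ h
    by_contra! hle
    linarith [hnonpos z hz hzβ hle]
  refine ⟨zc, (hsub hzc).1, (hsub hzc).2, hgt zc (hsub hzc).1 (hsub hzc).2 hzcm, ?_,
    fun z hz hzβ h => hgt z hz hzβ (h z₀ (by linarith) hz₀β)⟩
  intro z hz hzβ
  rcases le_total z (2 * c) with h | h
  · linarith [hnonpos z hz hzβ h]
  rcases le_or_gt z b with h' | h'
  · exact hmax (show z ∈ Set.Icc (2 * c) b from ⟨h, h'⟩)
  have hlz : l < (z : EReal) :=
    ((le_max_left _ _).trans_lt hb).trans (EReal.coe_lt_coe_iff.2 h')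
  have htail : z ^ 2 / S z < (z₀ ^ 2 - 2 * c * z₀) / S z₀ :=
    htsub (show (z : EReal) ∈ t from hlsub ⟨hlz, hzβ⟩)
  have hle : (z ^ 2 - 2 * c * z) / S z ≤ z ^ 2 / S z :=
    div_le_div_of_nonneg_right (by nlinarith) (hSpos z hz hzβ).le
  linarith
end

section
/- Assume in addition that S is differentiable on (0,β) with S'(z) > 0 for all z, and that the map z ↦ z·S'(z)/S(z) is nondecreasing on (0,β). Let c be a real number with 0 < 2c < β. Then there is at most one z ∈ (2c,β) satisfying (z - c)/(z/2 - c) = z·S'(z)/S(z); the function z ↦ (z^2 - 2cz)/S(z) has a unique maximizer z_c on (0,β), z_c ∈ (2c,β), and z_c satisfies (z_c - c)/(z_c/2 - c) = z_c·S'(z_c)/S(z_c). -/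
open Filter

/-- Under the Case (I) assumptions, if moreover `S` is differentiable with positive
derivative `S'` and `z ↦ z·S'(z)/S(z)` is nondecreasing on `(0, β)`, then for
`0 < 2c < β` there is at most one `z ∈ (2c, β)` with `(z - c)/(z/2 - c) = z·S'(z)/S(z)`,
the function `z ↦ (z² - 2cz)/S(z)` has a unique maximizer `z_c` on `(0, β)`,
`z_c ∈ (2c, β)`, and `z_c` satisfies the first-order condition. -/
theorem unique_maximizer_first_order_condition
    (β : EReal) (hβ : 0 < β) (S S' : ℝ → ℝ)
    (hScont : ContinuousOn S {z : ℝ | 0 < z ∧ (z : EReal) < β})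
    (hSmono : StrictMonoOn S {z : ℝ | 0 < z ∧ (z : EReal) < β})
    (hSpos : ∀ z : ℝ, 0 < z → (z : EReal) < β → 0 < S z)
    (hS0 : Tendsto S (nhdsWithin 0 (Set.Ioi 0)) (nhds 0))
    (hSβ : Tendsto (fun z : ℝ => z ^ 2 / S z)
      (comap (fun z : ℝ => (z : EReal)) (nhdsWithin β (Set.Iio β))) (nhds 0))
    (hS' : ∀ z : ℝ, 0 < z → (z : EReal) < β → HasDerivAt S (S' z) z)
    (hS'pos : ∀ z : ℝ, 0 < z → (z : EReal) < β → 0 < S' z)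
    (hratio : ∀ z₁ z₂ : ℝ, 0 < z₁ → (z₁ : EReal) < β → 0 < z₂ → (z₂ : EReal) < β →
      z₁ ≤ z₂ → z₁ * S' z₁ / S z₁ ≤ z₂ * S' z₂ / S z₂)
    (c : ℝ) (hc : 0 < c) (hcβ : ((2 * c : ℝ) : EReal) < β) :
    (∀ z₁ z₂ : ℝ, 2 * c < z₁ → (z₁ : EReal) < β → 2 * c < z₂ → (z₂ : EReal) < β →
      (z₁ - c) / (z₁ / 2 - c) = z₁ * S' z₁ / S z₁ →
      (z₂ - c) / (z₂ / 2 - c) = z₂ * S' z₂ / S z₂ → z₁ = z₂) ∧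
    ∃ zc : ℝ, 0 < zc ∧ (zc : EReal) < β ∧ 2 * c < zc ∧
      (zc - c) / (zc / 2 - c) = zc * S' zc / S zc ∧
      (∀ z : ℝ, 0 < z → (z : EReal) < β →
        (z ^ 2 - 2 * c * z) / S z ≤ (zc ^ 2 - 2 * c * zc) / S zc) ∧
      (∀ z : ℝ, 0 < z → (z : EReal) < β →
        (∀ w : ℝ, 0 < w → (w : EReal) < β →
          (w ^ 2 - 2 * c * w) / S w ≤ (z ^ 2 - 2 * c * z) / S z) → z = zc) := by
  set f : ℝ → ℝ := fun z => (z ^ 2 - 2 * c * z) / S z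
  have hcrit_unique : ∀ z₁ z₂ : ℝ, 2 * c < z₁ → (z₁ : EReal) < β →
      2 * c < z₂ → (z₂ : EReal) < β →
      (z₁ - c) / (z₁ / 2 - c) = z₁ * S' z₁ / S z₁ →
      (z₂ - c) / (z₂ / 2 - c) = z₂ * S' z₂ / S z₂ → ¬ z₁ < z₂ := by
    intro z₁ z₂ h₁ hb₁ h₂ hb₂ e₁ e₂ hlt
    have hle := hratio z₁ z₂ (by linarith) hb₁ (by linarith) hb₂ hlt.le
    rw [← e₁, ← e₂, div_le_div_iff₀ (by linarith) (by linarith)] at hle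
    nlinarith [mul_pos hc (sub_pos.2 hlt)]
  have hunique : ∀ z₁ z₂ : ℝ, 2 * c < z₁ → (z₁ : EReal) < β →
      2 * c < z₂ → (z₂ : EReal) < β →
      (z₁ - c) / (z₁ / 2 - c) = z₁ * S' z₁ / S z₁ →
      (z₂ - c) / (z₂ / 2 - c) = z₂ * S' z₂ / S z₂ → z₁ = z₂ := by
    intro z₁ z₂ h₁ hb₁ h₂ hb₂ e₁ e₂
    exact le_antisymm (not_lt.1 (hcrit_unique z₂ z₁ h₂ hb₂ h₁ hb₁ e₂ e₁))
      (not_lt.1 (hcrit_unique z₁ z₂ h₁ hb₁ h₂ hb₂ e₁ e₂))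
  have hcrit : ∀ z : ℝ, 2 * c < z → (z : EReal) < β →
      (∀ w : ℝ, 0 < w → (w : EReal) < β → f w ≤ f z) →
      (z - c) / (z / 2 - c) = z * S' z / S z := by
    intro z hz hzβ hmax
    have hz0 : 0 < z := by linarith
    have hS := hSpos z hz0 hzβ
    have hopen : IsOpen {w : ℝ | 0 < w ∧ (w : EReal) < β} :=
      isOpen_Ioi.inter (isOpen_Iio.preimage continuous_coe_real_ereal)
    have hloc : IsLocalMax f z :=
      Filter.mem_of_superset (hopen.mem_nhds ⟨hz0, hzβ⟩) fun w hw => hmax w hw.1 hw.2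
    have hnum : HasDerivAt (fun w : ℝ => w ^ 2 - 2 * c * w) (2 * z - 2 * c) z := by
      simpa using (hasDerivAt_pow 2 z).fun_sub ((hasDerivAt_id z).const_mul (2 * c))
    have hder := hloc.hasDerivAt_eq_zero (hnum.div (hS' z hz0 hzβ) hS.ne')
    rw [div_eq_zero_iff, or_iff_left (pow_ne_zero 2 hS.ne')] at hder
    rw [div_eq_div_iff (by linarith) hS.ne']
    linarith
  have hfpos : ∀ z : ℝ, 2 * c < z → (z : EReal) < β → 0 < f z := fun z hz hzβ =>
    div_pos (by nlinarith) (hSpos z (by linarith) hzβ)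
  have hfnonpos : ∀ z : ℝ, 0 < z → (z : EReal) < β → z ≤ 2 * c → f z ≤ 0 :=
    fun z hz hzβ hzc => div_nonpos_of_nonpos_of_nonneg (by nlinarith) (hSpos z hz hzβ).le
  obtain ⟨z₀, hz₀, hz₀β⟩ := EReal.lt_iff_exists_real_btwn.1 hcβ
  have hz₀c : 2 * c < z₀ := EReal.coe_lt_coe_iff.1 hz₀
  have hf₀ := hfpos z₀ hz₀c hz₀β
  obtain ⟨t, ht, hts⟩ := Filter.mem_comap.1 (hSβ.eventually (gt_mem_nhds hf₀))
  obtain ⟨l, hl, hlt⟩ := (mem_nhdsLT_iff_exists_Ioo_subset' hβ).1 ht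
  obtain ⟨b, hb, hbβ⟩ := EReal.lt_iff_exists_real_btwn.1 (max_lt hl hz₀β)
  have hz₀b : z₀ < b := EReal.coe_lt_coe_iff.1 ((le_max_right _ _).trans_lt hb)
  have hIcc : ∀ z ∈ Set.Icc (2 * c) b, 0 < z ∧ (z : EReal) < β := fun z hz =>
    ⟨by linarith [hz.1], (EReal.coe_le_coe_iff.2 hz.2).trans_lt hbβ⟩
  have hfcont : ContinuousOn f (Set.Icc (2 * c) b) :=
    ContinuousOn.div (by fun_prop) (hScont.mono hIcc)
      fun z hz => (hSpos z (hIcc z hz).1 (hIcc z hz).2).ne'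
  obtain ⟨zc, hzc, hzcmax⟩ :=
    isCompact_Icc.exists_isMaxOn ⟨z₀, hz₀c.le, hz₀b.le⟩ hfcont
  have hzc₀ : f z₀ ≤ f zc := hzcmax ⟨hz₀c.le, hz₀b.le⟩
  obtain ⟨hzcpos, hzcβ⟩ := hIcc zc hzc
  have hlarge : ∀ z : ℝ, 0 < z → (z : EReal) < β → 0 < f z → 2 * c < z :=
    fun z hz hzβ hfz => not_le.1 fun h => (hfnonpos z hz hzβ h).not_gt hfz
  have hzclarge := hlarge zc hzcpos hzcβ (hf₀.trans_le hzc₀)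
  have hmax : ∀ z : ℝ, 0 < z → (z : EReal) < β → f z ≤ f zc := by
    intro z hz hzβ
    rcases le_or_gt z (2 * c) with h | h
    · exact (hfnonpos z hz hzβ h).trans (hf₀.le.trans hzc₀)
    rcases le_or_gt z b with h' | h'
    · exact hzcmax ⟨h.le, h'⟩
    · have hsmall : z ^ 2 / S z < f z₀ := hts (hlt
        ⟨(le_max_left _ _).trans_lt (hb.trans (EReal.coe_lt_coe_iff.2 h')), hzβ⟩)
      have hle : f z ≤ z ^ 2 / S z :=
        div_le_div_of_nonneg_right (by nlinarith) (hSpos z hz hzβ).le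
      exact hle.trans (hsmall.le.trans hzc₀)
  have hzccrit := hcrit zc hzclarge hzcβ hmax
  refine ⟨hunique, zc, hzcpos, hzcβ, hzclarge, hzccrit, hmax, fun z hz hzβ hzmax => ?_⟩
  have hzlarge := hlarge z hz hzβ (hf₀.trans_le (hzmax z₀ (by linarith) hz₀β))
  exact hunique z zc hzlarge hzβ hzclarge hzcβ (hcrit z hzlarge hzβ hzmax) hzccrit
end

section
/- Fix x ∈ (0,β) and define v(z) = z² · (S(x)/S(z)) · (1 - S(x)/S(z)) for z ∈ [x,β). Then v attains its supremum over [x,β) at some point z* ∈ (x,β), and v(z*) > 0. -/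
open Filter

/-- Under the Case (I) assumptions, for fixed `x ∈ (0, β)` the function
`v(z) = z² · (S(x)/S(z)) · (1 - S(x)/S(z))` attains its supremum over `[x, β)` at some
point `z* ∈ (x, β)`, and `v(z*) > 0`. -/
theorem exists_maximizer_variance_value
    (β : EReal) (hβ : 0 < β) (S : ℝ → ℝ)
    (hScont : ContinuousOn S {z : ℝ | 0 < z ∧ (z : EReal) < β})
    (hSmono : StrictMonoOn S {z : ℝ | 0 < z ∧ (z : EReal) < β})
    (hSpos : ∀ z : ℝ, 0 < z → (z : EReal) < β → 0 < S z)
    (hS0 : Tendsto S (nhdsWithin 0 (Set.Ioi 0)) (nhds 0))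
    (hSβ : Tendsto (fun z : ℝ => z ^ 2 / S z)
      (comap (fun z : ℝ => (z : EReal)) (nhdsWithin β (Set.Iio β))) (nhds 0))
    (x : ℝ) (hx : 0 < x) (hxβ : (x : EReal) < β) :
    ∃ zs : ℝ, x < zs ∧ (zs : EReal) < β ∧
      (∀ z : ℝ, x ≤ z → (z : EReal) < β →
        z ^ 2 * (S x / S z) * (1 - S x / S z) ≤ zs ^ 2 * (S x / S zs) * (1 - S x / S zs)) ∧
      0 < zs ^ 2 * (S x / S zs) * (1 - S x / S zs) := by
  have hsub : ∀ {c : ℝ}, (c : EReal) < β →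
      Set.Icc x c ⊆ {z : ℝ | 0 < z ∧ (z : EReal) < β} := fun hc z hz =>
    ⟨hx.trans_le hz.1, (EReal.coe_le_coe_iff.2 hz.2).trans_lt hc⟩
  have hSx := hSpos x hx hxβ
  obtain ⟨y, hxy, hyβ⟩ := EReal.lt_iff_exists_real_btwn.1 hxβ
  have hxy' : x < y := EReal.coe_lt_coe_iff.1 hxy
  have hy : 0 < y := hx.trans hxy'
  have hSy := hSpos y hy hyβ
  have hvy : 0 < y ^ 2 * (S x / S y) * (1 - S x / S y) := by
    have hlt : S x / S y < 1 := (div_lt_one hSy).2 (hSmono ⟨hx, hxβ⟩ ⟨hy, hyβ⟩ hxy')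
    have : 0 < 1 - S x / S y := sub_pos.2 hlt
    positivity
  set v : ℝ → ℝ := fun z => z ^ 2 * (S x / S z) * (1 - S x / S z) with hv
  change 0 < v y at hvy
  have hev := hSβ.eventually (gt_mem_nhds (div_pos hvy hSx))
  rw [eventually_comap] at hev
  obtain ⟨l, hl, hlsub⟩ := (mem_nhdsLT_iff_exists_Ioo_subset' hyβ).1 hev
  obtain ⟨c, hc, hcβ⟩ := EReal.lt_iff_exists_real_btwn.1 (max_lt hl hyβ)
  have hyc : y < c := EReal.coe_lt_coe_iff.1 ((le_max_right _ _).trans_lt hc)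
  have htail : ∀ z : ℝ, c < z → (z : EReal) < β → v z ≤ v y := by
    intro z hcz hzβ
    have hz : 0 < z := hy.trans (hyc.trans hcz)
    have hSz := hSpos z hz hzβ
    have hbound : z ^ 2 / S z < v y / S x :=
      hlsub ⟨((le_max_left _ _).trans_lt hc).trans (EReal.coe_lt_coe_iff.2 hcz), hzβ⟩ z rfl
    rw [lt_div_iff₀ hSx] at hbound
    calc v z ≤ z ^ 2 * (S x / S z) :=
          mul_le_of_le_one_right (by positivity) (sub_le_self _ (by positivity))
      _ = z ^ 2 / S z * S x := by ring
      _ ≤ v y := hbound.le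
  have hcont : ContinuousOn v (Set.Icc x c) := by
    have hS := hScont.mono (hsub hcβ)
    have hdiv : ContinuousOn (fun z => S x / S z) (Set.Icc x c) :=
      continuousOn_const.div hS fun z hz =>
        (hSpos z (hsub hcβ hz).1 (hsub hcβ hz).2).ne'
    exact ((continuousOn_id.pow 2).mul hdiv).mul (continuousOn_const.sub hdiv)
  have hymem : y ∈ Set.Icc x c := ⟨hxy'.le, hyc.le⟩
  obtain ⟨zs, hzs, hmax⟩ := isCompact_Icc.exists_isMaxOn ⟨y, hymem⟩ hcont
  have hle : v y ≤ v zs := hmax hymem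
  have hpos : 0 < v zs := hvy.trans_le hle
  refine ⟨zs, lt_of_le_of_ne hzs.1 ?_, (hsub hcβ hzs).2, fun z hxz hzβ => ?_, hpos⟩
  · rintro rfl
    simp [hv, hSx.ne'] at hpos
  · rcases le_or_gt z c with hzc | hcz
    · exact hmax ⟨hxz, hzc⟩
    · exact (htail z hcz hzβ).trans hle
end

section
/- Assume in addition that S is differentiable on (0,β) with S'(z) > 0 for all z, and that the map z ↦ z·S'(z)/S(z) is nondecreasing on (0,β). Fix x ∈ (0,β) and define v(z) = z² · (S(x)/S(z)) · (1 - S(x)/S(z)) for z ∈ [x,β). Then the equation (S(z) - S(x))/((1/2)S(z) - S(x)) = z·S'(z)/S(z) has exactly one solution z* in the set {z ∈ (x,β) : S(z) > 2S(x)}, this z* is the unique maximizer of v on [x,β), and the maximal value equals (z*)² · (S(x)/S(z*)) · (1 - S(x)/S(z*)). -/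
open Filter

/-- The derivative of `w ↦ w² · (c/S(w)) · (1 - c/S(w))`. -/
lemma hasDerivAt_sq_mul_div_mul_one_sub_div {S : ℝ → ℝ} {s z : ℝ} (c : ℝ)
    (hS : HasDerivAt S s z) (hz : S z ≠ 0) :
    HasDerivAt (fun w => w ^ 2 * (c / S w) * (1 - c / S w))
      (c * z / S z ^ 2 * (2 * (S z - c) - z * s / S z * (S z - 2 * c))) z := by
  have hdiv : HasDerivAt (fun w => c / S w) ((0 * S z - c * s) / S z ^ 2) z :=
    (hasDerivAt_const z c).fun_div hS hz
  refine (((hasDerivAt_pow 2 z).fun_mul hdiv).fun_mul (hdiv.const_sub 1)).congr_deriv ?_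
  field_simp
  push_cast
  ring

/-- A vanishing first-order expression with positive elasticity `r` forces `2 * a < b`. -/
lemma two_mul_lt_and_div_eq_of_first_order {a b r : ℝ} (hab : a < b) (hr : 0 < r)
    (h : 2 * (b - a) - r * (b - 2 * a) = 0) :
    2 * a < b ∧ (b - a) / ((1 / 2) * b - a) = r := by
  have hb : 2 * a < b := by
    by_contra! hle
    nlinarith [mul_nonneg hr.le (sub_nonneg.2 hle)]
  refine ⟨hb, ?_⟩
  rw [div_eq_iff (by linarith)]
  linarith

/-- The map `t ↦ (t - a)/(t/2 - a)` is strictly decreasing on `(2a, ∞)`. -/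
lemma sub_div_half_sub_strictAnti {a b c : ℝ} (ha : 0 < a) (hb : 2 * a < b) (hbc : b < c) :
    (c - a) / ((1 / 2) * c - a) < (b - a) / ((1 / 2) * b - a) := by
  rw [div_lt_div_iff₀ (by linarith) (by linarith)]
  nlinarith [mul_pos ha (sub_pos.2 hbc)]

/-- A function on `[x, β)` that is eventually below one of its values near `β` attains its
maximum. -/
lemma exists_isMax_of_eventually_lt {β : EReal} {f : ℝ → ℝ} {x w : ℝ}
    (hf : ContinuousOn f {z : ℝ | x ≤ z ∧ (z : EReal) < β}) (hxw : x ≤ w) (hw : (w : EReal) < β)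
    (hlt : ∀ᶠ z in comap (fun z : ℝ => (z : EReal)) (nhdsWithin β (Set.Iio β)), f z < f w) :
    ∃ m : ℝ, x ≤ m ∧ (m : EReal) < β ∧ ∀ z : ℝ, x ≤ z → (z : EReal) < β → f z ≤ f m := by
  obtain ⟨t, ht, hts⟩ := mem_comap.1 hlt
  obtain ⟨l, hl, hlt⟩ := (mem_nhdsLT_iff_exists_Ioo_subset' hw).1 ht
  obtain ⟨b, hlb, hbβ⟩ := EReal.lt_iff_exists_real_btwn.1 (max_lt hl hw)
  have hwb : w < b := EReal.coe_lt_coe_iff.1 ((le_max_right _ _).trans_lt hlb)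
  obtain ⟨m, hm, hmax⟩ := (isCompact_Icc (a := x) (b := b)).exists_isMaxOn
    ⟨w, hxw, hwb.le⟩ (hf.mono fun z hz =>
      ⟨hz.1, (EReal.coe_le_coe_iff.2 hz.2).trans_lt hbβ⟩)
  refine ⟨m, hm.1, (EReal.coe_le_coe_iff.2 hm.2).trans_lt hbβ, fun z hxz hzβ => ?_⟩
  rcases le_or_gt z b with hzb | hbz
  · exact hmax ⟨hxz, hzb⟩
  · have hz : f z < f w := hts (hlt
      ⟨((le_max_left _ _).trans_lt hlb).trans (EReal.coe_lt_coe_iff.2 hbz), hzβ⟩)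
    exact hz.le.trans (hmax ⟨hxw, hwb.le⟩)

/-- Under the Case (I) assumptions with differentiable `S`, positive derivative `S'`, and
`z ↦ z·S'(z)/S(z)` nondecreasing on `(0, β)`: for fixed `x ∈ (0, β)` the equation
`(S(z) - S(x))/((1/2)S(z) - S(x)) = z·S'(z)/S(z)` has exactly one solution `z*` in
`{z ∈ (x, β) : S(z) > 2S(x)}`, this `z*` is the unique maximizer of
`v(z) = z² · (S(x)/S(z)) · (1 - S(x)/S(z))` on `[x, β)`, and the maximum equals `v(z*)`. -/
theorem unique_maximizer_variance_first_order_condition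
    (β : EReal) (hβ : 0 < β) (S S' : ℝ → ℝ)
    (hScont : ContinuousOn S {z : ℝ | 0 < z ∧ (z : EReal) < β})
    (hSmono : StrictMonoOn S {z : ℝ | 0 < z ∧ (z : EReal) < β})
    (hSpos : ∀ z : ℝ, 0 < z → (z : EReal) < β → 0 < S z)
    (hS0 : Tendsto S (nhdsWithin 0 (Set.Ioi 0)) (nhds 0))
    (hSβ : Tendsto (fun z : ℝ => z ^ 2 / S z)
      (comap (fun z : ℝ => (z : EReal)) (nhdsWithin β (Set.Iio β))) (nhds 0))
    (hS' : ∀ z : ℝ, 0 < z → (z : EReal) < β → HasDerivAt S (S' z) z)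
    (hS'pos : ∀ z : ℝ, 0 < z → (z : EReal) < β → 0 < S' z)
    (hratio : ∀ z₁ z₂ : ℝ, 0 < z₁ → (z₁ : EReal) < β → 0 < z₂ → (z₂ : EReal) < β →
      z₁ ≤ z₂ → z₁ * S' z₁ / S z₁ ≤ z₂ * S' z₂ / S z₂)
    (x : ℝ) (hx : 0 < x) (hxβ : (x : EReal) < β) :
    ∃ zs : ℝ,
      (x < zs ∧ (zs : EReal) < β ∧ 2 * S x < S zs ∧
        (S zs - S x) / ((1 / 2) * S zs - S x) = zs * S' zs / S zs) ∧
      (∀ z : ℝ, x < z → (z : EReal) < β → 2 * S x < S z →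
        (S z - S x) / ((1 / 2) * S z - S x) = z * S' z / S z → z = zs) ∧
      (∀ z : ℝ, x ≤ z → (z : EReal) < β →
        z ^ 2 * (S x / S z) * (1 - S x / S z) ≤ zs ^ 2 * (S x / S zs) * (1 - S x / S zs)) ∧
      (∀ z : ℝ, x ≤ z → (z : EReal) < β →
        (∀ w : ℝ, x ≤ w → (w : EReal) < β →
          w ^ 2 * (S x / S w) * (1 - S x / S w) ≤ z ^ 2 * (S x / S z) * (1 - S x / S z)) →
        z = zs) := by
  have hpos : ∀ z, x ≤ z → 0 < z := fun z hz => hx.trans_le hz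
  have hSx : 0 < S x := hSpos x hx hxβ
  have hSlt : ∀ z, x < z → (z : EReal) < β → S x < S z := fun z hz hzβ =>
    hSmono ⟨hx, hxβ⟩ ⟨hpos z hz.le, hzβ⟩ hz
  set v : ℝ → ℝ := fun z => z ^ 2 * (S x / S z) * (1 - S x / S z) with hv
  have hvderiv : ∀ z, x ≤ z → (z : EReal) < β → HasDerivAt v
      (S x * z / S z ^ 2 * (2 * (S z - S x) - z * S' z / S z * (S z - 2 * S x))) z :=
    fun z hz hzβ => hasDerivAt_sq_mul_div_mul_one_sub_div (S x) (hS' z (hpos z hz) hzβ)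
      (hSpos z (hpos z hz) hzβ).ne'
  have hvx : v x = 0 := by simp [hv, div_self hSx.ne']
  have hvpos : ∀ z, x < z → (z : EReal) < β → 0 < v z := fun z hz hzβ => by
    have hz0 := hpos z hz.le
    have hSz := hSpos z hz0 hzβ
    have hquot : S x / S z < 1 := (div_lt_one hSz).2 (hSlt z hz hzβ)
    exact mul_pos (by positivity) (sub_pos.2 hquot)
  obtain ⟨w, hxw, hwβ⟩ := EReal.lt_iff_exists_real_btwn.1 hxβ
  replace hxw : x < w := EReal.coe_lt_coe_iff.1 hxw
  have hcrit : ∀ z, x ≤ z → (z : EReal) < β →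
      (∀ y : ℝ, x ≤ y → (y : EReal) < β → v y ≤ v z) →
      x < z ∧ 2 * S x < S z ∧ (S z - S x) / ((1 / 2) * S z - S x) = z * S' z / S z := by
    intro z hz hzβ hmax
    have hxz : x < z := by
      refine hz.lt_of_ne fun h => ?_
      have := hmax w hxw.le hwβ
      rw [← h, hvx] at this
      exact this.not_gt (hvpos w hxw hwβ)
    have hz0 := hpos z hz
    have hSz := hSpos z hz0 hzβ
    have hloc : IsLocalMax v z := by
      have hev : ∀ᶠ y : ℝ in nhds z, (y : EReal) < β :=
        continuous_coe_real_ereal.continuousAt.eventually (eventually_lt_nhds hzβ)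
      filter_upwards [hev, eventually_gt_nhds hxz] with y hyβ hxy using hmax y hxy.le hyβ
    have hzero := hloc.hasDerivAt_eq_zero (hvderiv z hz hzβ)
    have hfactor : S x * z / S z ^ 2 ≠ 0 := by positivity
    exact ⟨hxz, two_mul_lt_and_div_eq_of_first_order (hSlt z hxz hzβ)
      (div_pos (mul_pos hz0 (hS'pos z hz0 hzβ)) hSz)
      ((mul_eq_zero.1 hzero).resolve_left hfactor)⟩
  have hnotlt : ∀ y z : ℝ, x < y → (y : EReal) < β → 2 * S x < S y →
      (S y - S x) / ((1 / 2) * S y - S x) = y * S' y / S y → (z : EReal) < β →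
      (S z - S x) / ((1 / 2) * S z - S x) = z * S' z / S z → ¬ y < z := by
    intro y z hxy hyβ hSy hy hzβ hz hyz
    have hy0 := hpos y hxy.le
    have hz0 := hy0.trans hyz
    have hanti := sub_div_half_sub_strictAnti hSx hSy (hSmono ⟨hy0, hyβ⟩ ⟨hz0, hzβ⟩ hyz)
    rw [hy, hz] at hanti
    exact hanti.not_ge (hratio y z hy0 hyβ hz0 hzβ hyz.le)
  have huniq : ∀ y z : ℝ, x < y → (y : EReal) < β → 2 * S x < S y →
      (S y - S x) / ((1 / 2) * S y - S x) = y * S' y / S y →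
      x < z → (z : EReal) < β → 2 * S x < S z →
      (S z - S x) / ((1 / 2) * S z - S x) = z * S' z / S z → y = z :=
    fun y z hxy hyβ hSy hy hxz hzβ hSz hz => le_antisymm
      (not_lt.1 (hnotlt z y hxz hzβ hSz hz hyβ hy)) (not_lt.1 (hnotlt y z hxy hyβ hSy hy hzβ hz))
  have hlt : ∀ᶠ z in comap (fun z : ℝ => (z : EReal)) (nhdsWithin β (Set.Iio β)), v z < v w := by
    have hsmall := (hSβ.mul_const (S x)).eventually
      (eventually_lt_nhds (by simpa using hvpos w hxw hwβ))
    have hnear : ∀ᶠ z : ℝ in comap (fun z : ℝ => (z : EReal)) (nhdsWithin β (Set.Iio β)),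
        (x : EReal) < z ∧ (z : EReal) < β :=
      tendsto_comap.eventually (Ioo_mem_nhdsLT hxβ)
    filter_upwards [hsmall, hnear] with z hz hzβ
    have hz0 := hpos z (EReal.coe_lt_coe_iff.1 hzβ.1).le
    have hSz := hSpos z hz0 hzβ.2
    have hquot : 0 < S x / S z := div_pos hSx hSz
    calc v z ≤ z ^ 2 * (S x / S z) := mul_le_of_le_one_right (by positivity) (by linarith)
      _ = z ^ 2 / S z * S x := by ring
      _ < v w := hz
  obtain ⟨m, hxm, hmβ, hmax⟩ := exists_isMax_of_eventually_lt
    (fun z hz => (hvderiv z hz.1 hz.2).continuousAt.continuousWithinAt) hxw.le hwβ hlt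
  obtain ⟨hxm', hSm, hm⟩ := hcrit m hxm hmβ hmax
  refine ⟨m, ⟨hxm', hmβ, hSm, hm⟩, fun z hxz hzβ hSz hz =>
    huniq z m hxz hzβ hSz hz hxm' hmβ hSm hm, hmax, fun z hxz hzβ hzmax => ?_⟩
  obtain ⟨hxz', hSz, hz⟩ := hcrit z hxz hzβ hzmax
  exact huniq z m hxz' hzβ hSz hz hxm' hmβ hSm hm
end

section
/- Let α with -∞ ≤ α < β < ∞, and let S : (α,β] → ℝ be a continuous, strictly increasing function with lim_{y→α⁺} S(y) = -∞ and lim_{y→α⁺} y²/(-S(y)) = 0, differentiable on (α,β) with S'(y) > 0 for all y, and such that the map y ↦ S'(y)·(β - y)/(S(β) - S(y)) is nonincreasing on (α,β). Fix x ∈ (α,β) and define w(y) = (β - y)² · ((S(β) - S(x))/(S(β) - S(y))) · ((S(x) - S(y))/(S(β) - S(y))) for y ∈ (α,x]. Then the equation (S(x) - S(y))/(S(x) - (1/2)S(y) - (1/2)S(β)) = S'(y)·(β - y)/(S(β) - S(y)) has exactly one solution y* ∈ (α,x), this y* is the unique maximizer of w on (α,x], and the maximal value equals (β - y*)² · ((S(β)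 - S(x))/(S(β) - S(y*))) · ((S(x) - S(y*))/(S(β) - S(y*))). -/
open Filter

/-- Where it is positive, `t ↦ (s - t) / (s - t / 2 - b / 2)` exceeds all of its values to the
left. -/
theorem div_midpoint_lt_div_midpoint {b s t₁ t₂ : ℝ} (hb : s < b) (h₁ : t₁ < t₂) (h₂ : t₂ < s)
    (hpos : 0 < (s - t₂) / (s - (1 / 2) * t₂ - (1 / 2) * b)) :
    (s - t₁) / (s - (1 / 2) * t₁ - (1 / 2) * b)
      < (s - t₂) / (s - (1 / 2) * t₂ - (1 / 2) * b) := by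
  have hd₂ : 0 < s - (1 / 2) * t₂ - (1 / 2) * b :=
    (div_pos_iff_of_pos_left (sub_pos.2 h₂)).1 hpos
  have hd₁ : 0 < s - (1 / 2) * t₁ - (1 / 2) * b := by linarith
  rw [div_lt_div_iff₀ hd₁ hd₂]
  nlinarith [mul_pos (sub_pos.2 hb) (sub_pos.2 h₁)]

/-- The first-order condition for `(β - y)² (b - s) (s - S y) / (b - S y)²`. -/
theorem critical_equation_of_isLocalMax {S : ℝ → ℝ} {S₁ b s β y : ℝ} (hS : HasDerivAt S S₁ y)
    (hy : y < β) (hs : S y < s) (hb : s < b)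
    (hmax : IsLocalMax
      (fun y => (β - y) ^ 2 * ((b - s) / (b - S y)) * ((s - S y) / (b - S y))) y) :
    (s - S y) / (s - (1 / 2) * S y - (1 / 2) * b) = S₁ * (β - y) / (b - S y) := by
  have hD : 0 < b - S y := by linarith
  have hE : 0 < s - S y := by linarith
  have hβ : 0 < β - y := by linarith
  have hbs : 0 < b - s := by linarith
  have hderiv := ((((hasDerivAt_id y).const_sub β).pow 2).mul
    ((hasDerivAt_const y (b - s)).div (hS.const_sub b) hD.ne')).mul
    ((hS.const_sub s).div (hS.const_sub b) hD.ne')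
  have hzero := hmax.hasDerivAt_eq_zero hderiv
  simp only [id, Pi.pow_apply, Pi.mul_apply, Pi.div_apply] at hzero
  field_simp at hzero
  have hcrit : S₁ * (β - y) * (s - (1 / 2) * S y - (1 / 2) * b) = (s - S y) * (b - S y) := by
    refine mul_left_cancel₀ (mul_pos hβ hbs).ne' ?_
    norm_num at hzero
    linear_combination (1 / 2) * hzero
  have hd : s - (1 / 2) * S y - (1 / 2) * b ≠ 0 := by
    intro h
    rw [h, mul_zero] at hcrit
    exact (mul_pos hE hD).ne hcrit
  rw [div_eq_div_iff hd hD.ne', hcrit]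

/-- A decay condition relative to `-S` absorbs a translation of the argument. -/
theorem tendsto_mul_div_mul_div_of_tendsto_sq_div_neg {F : Filter ℝ} {S : ℝ → ℝ} (b s β : ℝ)
    (hS : Tendsto S F atBot) (hdecay : Tendsto (fun y => y ^ 2 / (-S y)) F (nhds 0)) :
    Tendsto (fun y => (β - y) ^ 2 * ((b - s) / (b - S y)) * ((s - S y) / (b - S y))) F
      (nhds 0) := by
  have hneg : Tendsto (fun y => -S y) F atTop := tendsto_neg_atBot_atTop.comp hS
  have hinv : Tendsto (fun y => (-S y)⁻¹) F (nhds 0) := tendsto_inv_atTop_zero.comp hneg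
  have hsq : Tendsto (fun y => (β - y) ^ 2 / (-S y)) F (nhds 0) := by
    have hub : Tendsto (fun y => 2 * β ^ 2 * (-S y)⁻¹ + 2 * (y ^ 2 / (-S y))) F (nhds 0) := by
      simpa using (hinv.const_mul (2 * β ^ 2)).add (hdecay.const_mul 2)
    refine tendsto_of_tendsto_of_tendsto_of_le_of_le' tendsto_const_nhds hub ?_ ?_
    · filter_upwards [hneg.eventually_gt_atTop 0] with y hy using by positivity
    · filter_upwards [hneg.eventually_gt_atTop 0] with y hy
      have h : (β - y) ^ 2 ≤ 2 * β ^ 2 + 2 * y ^ 2 := by nlinarith [sq_nonneg (β + y)]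
      calc (β - y) ^ 2 / (-S y) ≤ (2 * β ^ 2 + 2 * y ^ 2) / (-S y) := by gcongr
        _ = _ := by ring
  have hshift : ∀ c : ℝ, Tendsto (fun y => 1 + c * (-S y)⁻¹) F (nhds 1) := fun c => by
    simpa using (hinv.const_mul c).const_add 1
  have hlim := ((hsq.mul_const (b - s)).mul (hshift s)).div ((hshift b).pow 2) (by norm_num)
  simp only [zero_mul, zero_div] at hlim
  refine hlim.congr' ?_
  filter_upwards [hneg.eventually_gt_atTop 0, hneg.eventually_gt_atTop (-b)] with y hy hyb
  have hSy : S y ≠ 0 := (neg_pos.1 hy).ne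
  have hD : b - S y ≠ 0 := (by linarith : 0 < b - S y).ne'
  have h1 : ∀ c : ℝ, 1 + c * (-S y)⁻¹ = (c - S y) / (-S y) := fun c => by field_simp; ring
  simp only [Pi.div_apply, h1]
  field_simp

/-- Case (II): `α ≥ -∞` (modelled as `α : EReal`), `β < ∞`, scale function `S` on `(α, β]`
continuous and strictly increasing with `S(α⁺) = -∞`, decay `y²/(-S(y)) → 0` as `y → α⁺`,
differentiable with positive derivative `S'` on `(α, β)`, and
`y ↦ S'(y)·(β - y)/(S(β) - S(y))` nonincreasing on `(α, β)`. For fixed `x ∈ (α, β)`, the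
equation `(S(x) - S(y))/(S(x) - S(y)/2 - S(β)/2) = S'(y)·(β - y)/(S(β) - S(y))` has exactly
one solution `y* ∈ (α, x)`, which is the unique maximizer on `(α, x]` of
`w(y) = (β - y)² · ((S(β) - S(x))/(S(β) - S(y))) · ((S(x) - S(y))/(S(β) - S(y)))`,
and the maximal value equals `w(y*)`. -/
theorem unique_maximizer_case_two
    (α : EReal) (β : ℝ) (hαβ : α < (β : EReal)) (S S' : ℝ → ℝ)
    (hScont : ContinuousOn S {y : ℝ | α < (y : EReal) ∧ y ≤ β})
    (hSmono : StrictMonoOn S {y : ℝ | α < (y : EReal) ∧ y ≤ β})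
    (hSα : Tendsto S (comap (fun y : ℝ => (y : EReal)) (nhdsWithin α (Set.Ioi α))) atBot)
    (hdecay : Tendsto (fun y : ℝ => y ^ 2 / (-S y))
      (comap (fun y : ℝ => (y : EReal)) (nhdsWithin α (Set.Ioi α))) (nhds 0))
    (hS' : ∀ y : ℝ, α < (y : EReal) → y < β → HasDerivAt S (S' y) y)
    (hS'pos : ∀ y : ℝ, α < (y : EReal) → y < β → 0 < S' y)
    (hratio : ∀ y₁ y₂ : ℝ, α < (y₁ : EReal) → y₁ < β → α < (y₂ : EReal) → y₂ < β →
      y₁ ≤ y₂ → S' y₂ * (β - y₂) / (S β - S y₂) ≤ S' y₁ * (β - y₁) / (S β - S y₁))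
    (x : ℝ) (hxα : α < (x : EReal)) (hxβ : x < β) :
    ∃ ys : ℝ,
      (α < (ys : EReal) ∧ ys < x ∧
        (S x - S ys) / (S x - (1 / 2) * S ys - (1 / 2) * S β)
          = S' ys * (β - ys) / (S β - S ys)) ∧
      (∀ y : ℝ, α < (y : EReal) → y < x →
        (S x - S y) / (S x - (1 / 2) * S y - (1 / 2) * S β)
          = S' y * (β - y) / (S β - S y) → y = ys) ∧
      (∀ y : ℝ, α < (y : EReal) → y ≤ x →
        (β - y) ^ 2 * ((S β - S x) / (S β - S y)) * ((S x - S y) / (S β - S y))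
          ≤ (β - ys) ^ 2 * ((S β - S x) / (S β - S ys)) * ((S x - S ys) / (S β - S ys))) ∧
      (∀ y : ℝ, α < (y : EReal) → y ≤ x →
        (∀ y' : ℝ, α < (y' : EReal) → y' ≤ x →
          (β - y') ^ 2 * ((S β - S x) / (S β - S y')) * ((S x - S y') / (S β - S y'))
            ≤ (β - y) ^ 2 * ((S β - S x) / (S β - S y)) * ((S x - S y) / (S β - S y))) →
        y = ys) := by
  have hx_mem : x ∈ {y : ℝ | α < (y : EReal) ∧ y ≤ β} := ⟨hxα, hxβ.le⟩
  have hSxβ : S x < S β := hSmono hx_mem ⟨hαβ, le_rfl⟩ hxβ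
  have hSlt : ∀ {y : ℝ}, α < (y : EReal) → y < x → S y < S x := fun hy hyx =>
    hSmono ⟨hy, (hyx.trans hxβ).le⟩ hx_mem hyx
  set w : ℝ → ℝ := fun y =>
    (β - y) ^ 2 * ((S β - S x) / (S β - S y)) * ((S x - S y) / (S β - S y)) with hw
  have hw_pos : ∀ {y : ℝ}, α < (y : EReal) → y < x → 0 < w y := by
    intro y hy hyx
    have h := hSlt hy hyx
    have h₁ : 0 < β - y := by linarith
    have h₂ : 0 < S β - S y := by linarith
    have h₃ : 0 < S x - S y := by linarith
    have h₄ : 0 < S β - S x := by linarith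
    positivity
  have hw_x : w x = 0 := by simp [hw]
  have hcrit : ∀ {y : ℝ}, α < (y : EReal) → y ≤ x →
      (∀ y' : ℝ, α < (y' : EReal) → y' ≤ x → w y' ≤ w y) →
      y < x ∧ (S x - S y) / (S x - (1 / 2) * S y - (1 / 2) * S β)
        = S' y * (β - y) / (S β - S y) := by
    intro y hy hyx hmax
    obtain ⟨z, hz, hzx⟩ := EReal.lt_iff_exists_real_btwn.1 hxα
    have hzx' : z < x := EReal.coe_lt_coe_iff.1 hzx
    have hlt : y < x := by
      refine lt_of_le_of_ne hyx ?_
      rintro rfl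
      exact absurd (hmax z hz hzx'.le) (by rw [hw_x]; exact (hw_pos hz hzx').not_ge)
    refine ⟨hlt, critical_equation_of_isLocalMax (hS' y hy (hlt.trans hxβ)) (hlt.trans hxβ)
      (hSlt hy hlt) hSxβ ?_⟩
    filter_upwards [continuous_coe_real_ereal.continuousAt.eventually (lt_mem_nhds hy),
      gt_mem_nhds hlt] with y' h₁ h₂ using hmax y' h₁ h₂.le
  have huniq : ∀ {y₁ y₂ : ℝ}, α < (y₁ : EReal) → y₁ < y₂ → y₂ < x →
      (S x - S y₁) / (S x - (1 / 2) * S y₁ - (1 / 2) * S β)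
        = S' y₁ * (β - y₁) / (S β - S y₁) →
      (S x - S y₂) / (S x - (1 / 2) * S y₂ - (1 / 2) * S β)
        = S' y₂ * (β - y₂) / (S β - S y₂) → False := by
    intro y₁ y₂ hy₁ h₁₂ h₂x e₁ e₂
    have hy₂ : α < (y₂ : EReal) := hy₁.trans (EReal.coe_lt_coe_iff.2 h₁₂)
    have hr : 0 < S' y₂ * (β - y₂) / (S β - S y₂) :=
      div_pos (mul_pos (hS'pos y₂ hy₂ (h₂x.trans hxβ)) (by linarith))
        (by linarith [hSlt hy₂ h₂x])
    have h := div_midpoint_lt_div_midpoint hSxβ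
      (hSmono ⟨hy₁, by linarith⟩ ⟨hy₂, by linarith⟩ h₁₂) (hSlt hy₂ h₂x) (e₂ ▸ hr)
    rw [e₁, e₂] at h
    exact (hratio y₁ y₂ hy₁ (by linarith) hy₂ (by linarith) h₁₂.le).not_gt h
  have hexists : ∃ ys : ℝ, α < (ys : EReal) ∧ ys ≤ x ∧
      ∀ y : ℝ, α < (y : EReal) → y ≤ x → w y ≤ w ys := by
    obtain ⟨z, hz, hzx⟩ := EReal.lt_iff_exists_real_btwn.1 hxα
    have hzx' : z < x := EReal.coe_lt_coe_iff.1 hzx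
    have hlim : Tendsto w _ (nhds 0) :=
      tendsto_mul_div_mul_div_of_tendsto_sq_div_neg (S β) (S x) β hSα hdecay
    obtain ⟨t, ht, hts⟩ := mem_comap.1 (hlim.eventually (gt_mem_nhds (hw_pos hz hzx')))
    obtain ⟨u, hu, hut⟩ := (mem_nhdsGT_iff_exists_Ioo_subset' hz).1 ht
    obtain ⟨a, ha, hau⟩ := EReal.lt_iff_exists_real_btwn.1 (lt_min (Set.mem_Ioi.1 hu) hz)
    have hnear : ∀ y : ℝ, α < (y : EReal) → y ≤ a → w y < w z := fun y hy hya =>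
      hts (hut ⟨hy, (EReal.coe_le_coe_iff.2 hya).trans_lt (hau.trans_le (min_le_left _ _))⟩)
    have haz : a < z := EReal.coe_lt_coe_iff.1 (hau.trans_le (min_le_right _ _))
    have hsub : ∀ y ∈ Set.Icc a x, α < (y : EReal) := fun y hy =>
      ha.trans_le (EReal.coe_le_coe_iff.2 hy.1)
    have hS_cont : ContinuousOn S (Set.Icc a x) :=
      hScont.mono fun y hy => ⟨hsub y hy, hy.2.trans hxβ.le⟩
    have hD : ∀ y ∈ Set.Icc a x, S β - S y ≠ 0 := fun y hy =>
      (sub_pos.2 (hSmono ⟨hsub y hy, hy.2.trans hxβ.le⟩ ⟨hαβ, le_rfl⟩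
        (hy.2.trans_lt hxβ))).ne'
    have hw_cont : ContinuousOn w (Set.Icc a x) := by
      have hden := continuousOn_const (c := S β) |>.sub hS_cont
      exact (((continuousOn_const.sub continuousOn_id).pow 2).mul
        (continuousOn_const.div hden hD)).mul ((continuousOn_const.sub hS_cont).div hden hD)
    have hz_mem : z ∈ Set.Icc a x := ⟨haz.le, hzx'.le⟩
    obtain ⟨ys, hys, hmax⟩ := isCompact_Icc.exists_isMaxOn ⟨z, hz_mem⟩ hw_cont
    refine ⟨ys, hsub ys hys, hys.2, fun y hy hyx => ?_⟩
    rcases le_total y a with hya | hay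
    · exact (hnear y hy hya).le.trans (hmax hz_mem)
    · exact hmax ⟨hay, hyx⟩
  obtain ⟨ys, hysα, hysx, hmax⟩ := hexists
  obtain ⟨hlt, heq⟩ := hcrit hysα hysx hmax
  have hsol : ∀ y : ℝ, α < (y : EReal) → y < x →
      (S x - S y) / (S x - (1 / 2) * S y - (1 / 2) * S β)
        = S' y * (β - y) / (S β - S y) → y = ys := by
    intro y hy hyx he
    rcases lt_trichotomy y ys with h | h | h
    · exact (huniq hy h hlt he heq).elim
    · exact h
    · exact (huniq hysα h hyx heq he).elim
  refine ⟨ys, ⟨hysα, hlt, heq⟩, hsol, hmax, fun y hy hyx hy_max => ?_⟩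
  obtain ⟨hyx', he⟩ := hcrit hy hyx hy_max
  exact hsol y hy hyx' he
end

section
/- Fix x ∈ (0,β). Define Φ on the set D = {(a,b,c) : 0 ≤ a ≤ x ≤ b < β, c ≥ 0} by Φ(a,b,c) = ((S(b) - S(x))/(S(b) - S(a)))·(a - c)² + ((S(x) - S(a))/(S(b) - S(a)))·(b - c)² when a < b, and Φ(x,x,c) = (x - c)². Then Φ is continuous on D. -/
open Filter Topology in
/-- A function squeezed between the minimum and the maximum of two functions with the same limit
has that limit. -/
theorem tendsto_of_min_le_of_le_max {α : Type*} {l : Filter α} {f g h : α → ℝ} {y : ℝ}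
    (hf : Tendsto f l (𝓝 y)) (hg : Tendsto g l (𝓝 y))
    (hmin : ∀ᶠ z in l, min (f z) (g z) ≤ h z) (hmax : ∀ᶠ z in l, h z ≤ max (f z) (g z)) :
    Tendsto h l (𝓝 y) :=
  tendsto_of_tendsto_of_tendsto_of_le_of_le' (by simpa using hf.min hg) (by simpa using hf.max hg)
    hmin hmax

/-- A weighted mean with weights `(t - r) / (t - s)` and `(r - s) / (t - s)`, where
`s ≤ r ≤ t` and `s < t`, lies between the two values being averaged. -/
theorem weighted_mean_mem_Icc {s r t u v : ℝ} (hsr : s ≤ r) (hrt : r ≤ t) (hst : s < t) :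
    ((t - r) / (t - s)) * u + ((r - s) / (t - s)) * v ∈ Set.Icc (min u v) (max u v) := by
  have hpos : 0 < t - s := sub_pos.2 hst
  have hsum : (t - r) / (t - s) + (r - s) / (t - s) = 1 := by field_simp; ring
  have hw := div_nonneg (sub_nonneg.2 hrt) hpos.le
  have hw' := div_nonneg (sub_nonneg.2 hsr) hpos.le
  exact convex_Icc (min u v) (max u v) ⟨min_le_left _ _, le_max_left _ _⟩
    ⟨min_le_right _ _, le_max_right _ _⟩ hw hw' hsum

/-- Continuity of `Φ(a,b,c) = E_x[(X_{τ_{(a,b)}} - c)²]` (expressed through the scale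
function `S`) on the set `{(a,b,c) : 0 ≤ a ≤ x ≤ b < β, c ≥ 0}`, where
`Φ(a,b,c)` is the two-point formula for `a < b` and `Φ(x,x,c) = (x - c)²`. -/
theorem continuousOn_Phi
    (β : EReal) (hβ : 0 < β) (S : ℝ → ℝ)
    (hScont : ContinuousOn S {z : ℝ | 0 ≤ z ∧ (z : EReal) < β})
    (hSmono : StrictMonoOn S {z : ℝ | 0 ≤ z ∧ (z : EReal) < β})
    (x : ℝ) (hx : 0 < x) (hxβ : (x : EReal) < β) :
    ContinuousOn
      (fun p : ℝ × ℝ × ℝ =>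
        if p.1 < p.2.1 then
          ((S p.2.1 - S x) / (S p.2.1 - S p.1)) * (p.1 - p.2.2) ^ 2 +
          ((S x - S p.1) / (S p.2.1 - S p.1)) * (p.2.1 - p.2.2) ^ 2
        else (x - p.2.2) ^ 2)
      {p : ℝ × ℝ × ℝ |
        0 ≤ p.1 ∧ p.1 ≤ x ∧ x ≤ p.2.1 ∧ (p.2.1 : EReal) < β ∧ 0 ≤ p.2.2} := by
  set I : Set ℝ := {z : ℝ | 0 ≤ z ∧ (z : EReal) < β}
  set D : Set (ℝ × ℝ × ℝ) := {p : ℝ × ℝ × ℝ |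
    0 ≤ p.1 ∧ p.1 ≤ x ∧ x ≤ p.2.1 ∧ (p.2.1 : EReal) < β ∧ 0 ≤ p.2.2}
  have hxI : x ∈ I := ⟨hx.le, hxβ⟩
  have hfst : ∀ q ∈ D, q.1 ∈ I := fun q hq =>
    ⟨hq.1, (EReal.coe_le_coe_iff.2 hq.2.1).trans_lt hxβ⟩
  have hsnd : ∀ q ∈ D, q.2.1 ∈ I := fun q hq =>
    ⟨hx.le.trans hq.2.2.1, hq.2.2.2.1⟩
  have hSfst := hScont.comp (continuous_fst (X := ℝ) (Y := ℝ × ℝ)).continuousOn hfst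
  have hSsnd := hScont.comp
    (continuous_fst.comp (continuous_snd (X := ℝ) (Y := ℝ × ℝ))).continuousOn hsnd
  intro p hp
  by_cases hlt : p.1 < p.2.1
  · have hne : S p.2.1 - S p.1 ≠ 0 := (sub_pos.2 (hSmono (hfst p hp) (hsnd p hp) hlt)).ne'
    have hSa : ContinuousWithinAt (fun q : ℝ × ℝ × ℝ => S q.1) _ p := hSfst p hp
    have hSb : ContinuousWithinAt (fun q : ℝ × ℝ × ℝ => S q.2.1) _ p := hSsnd p hp
    have hformula := (((hSb.sub_const (S x)).div (hSb.sub hSa) hne).mul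
      (show Continuous fun q : ℝ × ℝ × ℝ => (q.1 - q.2.2) ^ 2 by
        fun_prop).continuousWithinAt).add
      (((hSa.const_sub (S x)).div (hSb.sub hSa) hne).mul
      (show Continuous fun q : ℝ × ℝ × ℝ => (q.2.1 - q.2.2) ^ 2 by
        fun_prop).continuousWithinAt)
    refine ContinuousWithinAt.congr_of_eventuallyEq hformula ?_ (if_pos hlt)
    have hopen : IsOpen {q : ℝ × ℝ × ℝ | q.1 < q.2.1} :=
      isOpen_lt (by fun_prop) (by fun_prop)
    filter_upwards [mem_nhdsWithin_of_mem_nhds (hopen.mem_nhds hlt)] with q hq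
    exact if_pos hq
  · have hpx : p.1 = x := le_antisymm hp.2.1 (hp.2.2.1.trans (not_lt.1 hlt))
    have hpx' : p.2.1 = x := le_antisymm ((not_lt.1 hlt).trans hp.2.1) hp.2.2.1
    have hleft : ContinuousWithinAt (fun q : ℝ × ℝ × ℝ => (q.1 - q.2.2) ^ 2) D p :=
      Continuous.continuousWithinAt (by fun_prop)
    have hright : ContinuousWithinAt (fun q : ℝ × ℝ × ℝ => (q.2.1 - q.2.2) ^ 2) D p :=
      Continuous.continuousWithinAt (by fun_prop)
    have hbetween : ∀ q ∈ D,
        (if q.1 < q.2.1 then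
          ((S q.2.1 - S x) / (S q.2.1 - S q.1)) * (q.1 - q.2.2) ^ 2 +
          ((S x - S q.1) / (S q.2.1 - S q.1)) * (q.2.1 - q.2.2) ^ 2
        else (x - q.2.2) ^ 2) ∈
          Set.Icc (min ((q.1 - q.2.2) ^ 2) ((q.2.1 - q.2.2) ^ 2))
            (max ((q.1 - q.2.2) ^ 2) ((q.2.1 - q.2.2) ^ 2)) := by
      intro q hq
      split_ifs with h
      · exact weighted_mean_mem_Icc (hSmono.monotoneOn (hfst q hq) hxI hq.2.1)
          (hSmono.monotoneOn hxI (hsnd q hq) hq.2.2.1) (hSmono (hfst q hq) (hsnd q hq) h)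
      · have hqx : q.1 = x := le_antisymm hq.2.1 (hq.2.2.1.trans (not_lt.1 h))
        rw [hqx]
        exact ⟨min_le_left _ _, le_max_left _ _⟩
    simp only [ContinuousWithinAt, hpx, hpx', lt_irrefl, if_false] at hleft hright ⊢
    exact tendsto_of_min_le_of_le_max hleft hright
      (by filter_upwards [self_mem_nhdsWithin] with q hq using (hbetween q hq).1)
      (by filter_upwards [self_mem_nhdsWithin] with q hq using (hbetween q hq).2)
end

section
/- Let c₁, c₂ be real numbers with 0 ≤ c₁ ≤ c₂, c₂ > 0 and 2c₂ < β. Then there exists Z ∈ (0,β) such that for every c ∈ [c₁,c₂], every point z ∈ (0,β) at which the function z ↦ (z² - 2cz)/S(z) attains its supremum over (0,β) satisfies z ≤ Z. -/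
open Filter

/-- Uniform boundedness of maximizers: for `0 ≤ c₁ ≤ c₂`, `c₂ > 0`, `2c₂ < β`, there is a
`Z ∈ (0, β)` such that for every `c ∈ [c₁, c₂]` every maximizer over `(0, β)` of
`z ↦ (z² - 2cz)/S(z)` is at most `Z`. -/
theorem maximizers_uniformly_bounded
    (β : EReal) (hβ : 0 < β) (S : ℝ → ℝ)
    (hScont : ContinuousOn S {z : ℝ | 0 < z ∧ (z : EReal) < β})
    (hSmono : StrictMonoOn S {z : ℝ | 0 < z ∧ (z : EReal) < β})
    (hSpos : ∀ z : ℝ, 0 < z → (z : EReal) < β → 0 < S z)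
    (hS0 : Tendsto S (nhdsWithin 0 (Set.Ioi 0)) (nhds 0))
    (hSβ : Tendsto (fun z : ℝ => z ^ 2 / S z)
      (comap (fun z : ℝ => (z : EReal)) (nhdsWithin β (Set.Iio β))) (nhds 0))
    (c₁ c₂ : ℝ) (hc₁ : 0 ≤ c₁) (hc₁₂ : c₁ ≤ c₂) (hc₂ : 0 < c₂)
    (hc₂β : ((2 * c₂ : ℝ) : EReal) < β) :
    ∃ Z : ℝ, 0 < Z ∧ (Z : EReal) < β ∧
      ∀ c ∈ Set.Icc c₁ c₂, ∀ z : ℝ, 0 < z → (z : EReal) < β →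
        (∀ w : ℝ, 0 < w → (w : EReal) < β →
          (w ^ 2 - 2 * c * w) / S w ≤ (z ^ 2 - 2 * c * z) / S z) → z ≤ Z := by
  obtain ⟨w, hcw, hwβ⟩ := EReal.lt_iff_exists_real_btwn.1 hc₂β
  have hcw' : 2 * c₂ < w := EReal.coe_lt_coe_iff.1 hcw
  have hw : 0 < w := by linarith
  have hm : 0 < (w ^ 2 - 2 * c₂ * w) / S w :=
    div_pos (by nlinarith) (hSpos w hw hwβ)
  obtain ⟨t, ht, hsub⟩ := mem_comap.1 (hSβ.eventually (gt_mem_nhds hm))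
  obtain ⟨a, ha, hat⟩ := (mem_nhdsLT_iff_exists_Ioo_subset' hβ).1 ht
  obtain ⟨Z, hZ, hZβ⟩ := EReal.lt_iff_exists_real_btwn.1 (max_lt (Set.mem_Iio.1 ha) hβ)
  have haZ : a < (Z : EReal) := (le_max_left _ _).trans_lt hZ
  have hZ0 : 0 < Z := EReal.coe_pos.1 ((le_max_right _ _).trans_lt hZ)
  refine ⟨Z, hZ0, hZβ, fun c hc z hz hzβ hmax => ?_⟩
  by_contra! hZz
  have hlt : z ^ 2 / S z < (w ^ 2 - 2 * c₂ * w) / S w :=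
    hsub (hat ⟨haZ.trans (EReal.coe_lt_coe_iff.2 hZz), hzβ⟩)
  have hSz := hSpos z hz hzβ
  have hSw := hSpos w hw hwβ
  have hcz : 0 ≤ c * z := mul_nonneg (hc₁.trans hc.1) hz.le
  have hcc : c * w ≤ c₂ * w := mul_le_mul_of_nonneg_right hc.2 hw.le
  have upper : (z ^ 2 - 2 * c * z) / S z ≤ z ^ 2 / S z :=
    div_le_div_of_nonneg_right (by linarith) hSz.le
  have lower : (w ^ 2 - 2 * c₂ * w) / S w ≤ (w ^ 2 - 2 * c * w) / S w :=
    div_le_div_of_nonneg_right (by linarith) hSw.le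
  linarith [hmax w hw hwβ]
end

section
/- Fix x ∈ (0,β) and let c_L be a real number with 0 < 2c_L < β. Then there exists c with c_L < c and 2c < β such that every point z ∈ (0,β) at which the function z ↦ (z² - 2cz)/S(z) attains its supremum over (0,β) satisfies z > x and z·S(x)/S(z) < c. -/
open Filter

/-- Existence of a level `c > c_L` (with `2c < β`) such that every maximizer `z` of
`z ↦ (z² - 2cz)/S(z)` over `(0, β)` satisfies `z > x` and `z·S(x)/S(z) < c`. -/
theorem exists_level_mean_below
    (β : EReal) (hβ : 0 < β) (S : ℝ → ℝ)
    (hScont : ContinuousOn S {z : ℝ | 0 < z ∧ (z : EReal) < β})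
    (hSmono : StrictMonoOn S {z : ℝ | 0 < z ∧ (z : EReal) < β})
    (hSpos : ∀ z : ℝ, 0 < z → (z : EReal) < β → 0 < S z)
    (hS0 : Tendsto S (nhdsWithin 0 (Set.Ioi 0)) (nhds 0))
    (hSβ : Tendsto (fun z : ℝ => z ^ 2 / S z)
      (comap (fun z : ℝ => (z : EReal)) (nhdsWithin β (Set.Iio β))) (nhds 0))
    (x : ℝ) (hx : 0 < x) (hxβ : (x : EReal) < β)
    (cL : ℝ) (hcL : 0 < cL) (hcLβ : ((2 * cL : ℝ) : EReal) < β) :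
    ∃ c : ℝ, cL < c ∧ ((2 * c : ℝ) : EReal) < β ∧
      ∀ z : ℝ, 0 < z → (z : EReal) < β →
        (∀ w : ℝ, 0 < w → (w : EReal) < β →
          (w ^ 2 - 2 * c * w) / S w ≤ (z ^ 2 - 2 * c * z) / S z) →
        x < z ∧ z * S x / S z < c := by
  have hSx := hSpos x hx hxβ
  have hε : 0 < 2 * cL ^ 2 / S x := by positivity
  have hev := hSβ.eventually (gt_mem_nhds hε)
  rw [eventually_comap] at hev
  obtain ⟨b, hbβ, hb⟩ := (nhdsLT_basis_of_exists_lt ⟨0, hβ⟩).eventually_iff.1 hev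
  obtain ⟨d, hd, hdβ⟩ := EReal.lt_iff_exists_real_btwn.1
    (max_lt hbβ (max_lt hxβ hcLβ) : max b (max (x : EReal) ((2 * cL : ℝ) : EReal)) < β)
  obtain ⟨hbd, hd⟩ := max_lt_iff.1 hd
  obtain ⟨hxd, hcd⟩ := max_lt_iff.1 hd
  rw [EReal.coe_lt_coe_iff] at hxd hcd
  obtain ⟨w, hdw, hwβ⟩ := EReal.lt_iff_exists_real_btwn.1 hdβ
  rw [EReal.coe_lt_coe_iff] at hdw
  have hw : 0 < w := by linarith
  refine ⟨d / 2, by linarith, by rwa [mul_div_cancel₀ d two_ne_zero], fun z hz hzβ hmax => ?_⟩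
  have hSz := hSpos z hz hzβ
  have hpos : 0 < (z ^ 2 - 2 * (d / 2) * z) / S z :=
    lt_of_lt_of_le (div_pos (by nlinarith) (hSpos w hw hwβ)) (hmax w hw hwβ)
  have hdz : d < z := by
    have h := (div_pos_iff_of_pos_right hSz).1 hpos
    by_contra! hle
    nlinarith
  refine ⟨hxd.trans hdz, ?_⟩
  have hlt := hb ⟨hbd.trans (EReal.coe_lt_coe_iff.2 hdz), hzβ⟩ z rfl
  rw [div_lt_div_iff₀ hSz hSx] at hlt
  rw [div_lt_iff₀ hSz]
  have hd0 : 0 < d := hx.trans hxd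
  have h1 : d * (z * S x) ≤ z ^ 2 * S x := by
    nlinarith [mul_pos (mul_pos hz hSx) (sub_pos.2 hdz)]
  have h2 : 2 * cL ^ 2 * S z ≤ d * (d / 2 * S z) := by
    nlinarith [mul_le_mul_of_nonneg_right (by nlinarith : 2 * cL ^ 2 ≤ d * (d / 2)) hSz.le]
  exact lt_of_mul_lt_mul_left (by linarith) hd0.le
end

section
/- Fix x ∈ (0,β) and suppose that for every c with 0 < 2c < β, every point of (0,β) at which z ↦ (z² - 2cz)/S(z) attains its supremum over (0,β) lies in (x,β). Then there exists c_L with 0 < 2c_L < β such that every point z at which z ↦ (z² - 2c_L·z)/S(z) attains its supremum over (0,β) satisfies z·S(x)/S(z) > c_L. -/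
open Filter

/-- Off a bounded set, `z ^ 2 / S z` is smaller than any prescribed positive number. -/
lemma exists_bound_of_tendsto_sq_div {β : EReal} (hβ : 0 < β) {S : ℝ → ℝ}
    (hSβ : Tendsto (fun z : ℝ => z ^ 2 / S z)
      (comap (fun z : ℝ => (z : EReal)) (nhdsWithin β (Set.Iio β))) (nhds 0))
    {ε : ℝ} (hε : 0 < ε) :
    ∃ K : ℝ, 0 < K ∧ ∀ z : ℝ, (z : EReal) < β → K < z → z ^ 2 / S z < ε := by
  have hev := hSβ.eventually (gt_mem_nhds hε)
  rw [eventually_comap, eventually_nhdsWithin_iff] at hev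
  induction β with
  | bot => simp at hβ
  | coe b =>
    refine ⟨b, by exact_mod_cast hβ, fun z hz hbz => ?_⟩
    exact absurd (EReal.coe_lt_coe_iff.mp hz) hbz.not_gt
  | top =>
    obtain ⟨K, hK⟩ := EReal.mem_nhds_top_iff.mp hev
    refine ⟨max K 1, by positivity, fun z hz hKz => ?_⟩
    exact hK (EReal.coe_lt_coe_iff.mpr ((le_max_left K 1).trans_lt hKz)) hz z rfl

/-- If for every `c` with `0 < 2c < β` all maximizers over `(0, β)` of
`z ↦ (z² - 2cz)/S(z)` lie in `(x, β)`, then there is a level `c_L` (with `0 < 2c_L < β`)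
such that every maximizer `z` for `c_L` satisfies `z·S(x)/S(z) > c_L`. -/
theorem exists_level_mean_above
    (β : EReal) (hβ : 0 < β) (S : ℝ → ℝ)
    (hScont : ContinuousOn S {z : ℝ | 0 < z ∧ (z : EReal) < β})
    (hSmono : StrictMonoOn S {z : ℝ | 0 < z ∧ (z : EReal) < β})
    (hSpos : ∀ z : ℝ, 0 < z → (z : EReal) < β → 0 < S z)
    (hS0 : Tendsto S (nhdsWithin 0 (Set.Ioi 0)) (nhds 0))
    (hSβ : Tendsto (fun z : ℝ => z ^ 2 / S z)
      (comap (fun z : ℝ => (z : EReal)) (nhdsWithin β (Set.Iio β))) (nhds 0))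
    (x : ℝ) (hx : 0 < x) (hxβ : (x : EReal) < β)
    (hall : ∀ c : ℝ, 0 < c → ((2 * c : ℝ) : EReal) < β →
      ∀ z : ℝ, 0 < z → (z : EReal) < β →
        (∀ w : ℝ, 0 < w → (w : EReal) < β →
          (w ^ 2 - 2 * c * w) / S w ≤ (z ^ 2 - 2 * c * z) / S z) → x < z) :
    ∃ cL : ℝ, 0 < cL ∧ ((2 * cL : ℝ) : EReal) < β ∧
      ∀ z : ℝ, 0 < z → (z : EReal) < β →
        (∀ w : ℝ, 0 < w → (w : EReal) < β →
          (w ^ 2 - 2 * cL * w) / S w ≤ (z ^ 2 - 2 * cL * z) / S z) →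
        cL < z * S x / S z := by
  have hSx := hSpos x hx hxβ
  obtain ⟨K, hK0, hK⟩ := exists_bound_of_tendsto_sq_div hβ hSβ
    (show 0 < x ^ 2 / 2 / S x by positivity)
  obtain ⟨c, hc0, hcx, hcK⟩ : ∃ c : ℝ, 0 < c ∧ c ≤ x / 4 ∧ c * K < x ^ 2 / 2 := by
    refine ⟨min (x / 4) (x ^ 2 / 4 / K), by positivity, min_le_left _ _, ?_⟩
    have h := (le_div_iff₀ hK0).mp (min_le_right (x / 4) (x ^ 2 / 4 / K))
    nlinarith [sq_pos_of_pos hx]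
  refine ⟨c, hc0, lt_trans (EReal.coe_lt_coe_iff.mpr (by linarith)) hxβ, fun z hz hzβ hmax => ?_⟩
  have hSz := hSpos z hz hzβ
  have hlow : x ^ 2 / 2 / S x ≤ (z ^ 2 - 2 * c * z) / S z :=
    le_trans (by gcongr; nlinarith) (hmax x hx hxβ)
  have hzK : z ≤ K := by
    by_contra! h
    have hle : (z ^ 2 - 2 * c * z) / S z ≤ z ^ 2 / S z := by
      gcongr
      nlinarith [mul_pos hc0 hz]
    linarith [hK z hzβ h]
  rw [div_le_div_iff₀ hSx hSz] at hlow
  rw [lt_div_iff₀ hSz]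
  by_contra! h
  have hz2 : 0 < z - 2 * c := by
    have hpos : 0 < x ^ 2 / 2 * S z := by positivity
    have hprod : 0 < (z - 2 * c) * (z * S x) := by linarith
    exact pos_of_mul_pos_left hprod (by positivity)
  have hmul : x ^ 2 / 2 * S z ≤ (z - 2 * c) * c * S z := by
    linarith [mul_le_mul_of_nonneg_left h hz2.le]
  have hle : x ^ 2 / 2 ≤ (z - 2 * c) * c := le_of_mul_le_mul_right hmul hSz
  nlinarith [mul_le_mul_of_nonneg_left hzK hc0.le]
end

section
/- Let σ > 0 and μ < -σ²/2, and set γ = 1 - 2μ/σ² (so γ > 2). Fix x > 0 and define v(z) = z² · (x/z)^γ · (1 - (x/z)^γ) for z ∈ [x,∞). Then v attains its maximum over [x,∞) at the unique point z* = (2μ/(μ + σ²/2))^{σ²/(σ² - 2μ)} · x, and the maximal value equals x² · ( (2μ/(μ + σ²/2))^{(σ² + 2μ)/(σ² - 2μ)} − (2μ/(μ + σ²/2))^{4μ/(σ² - 2μ)} ). -/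
/-- In the coordinate `t = z / x`, the stopped variance is a difference of two powers. -/
lemma sq_mul_rpow_mul_one_sub_rpow {x t : ℝ} (γ : ℝ) (hx : 0 < x) (ht : 0 < t) :
    (t * x) ^ 2 * (x / (t * x)) ^ γ * (1 - (x / (t * x)) ^ γ) =
      x ^ 2 * (t ^ (2 - γ) - t ^ (2 - 2 * γ)) := by
  have hdiv : x / (t * x) = t⁻¹ := by field_simp
  have h₁ : t ^ (2 - γ) = t ^ 2 * (t⁻¹) ^ γ := by
    rw [Real.inv_rpow ht.le, Real.rpow_sub ht, Real.rpow_two, div_eq_mul_inv]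
  have h₂ : t ^ (2 - 2 * γ) = t ^ 2 * ((t⁻¹) ^ γ) ^ 2 := by
    rw [Real.inv_rpow ht.le, Real.rpow_sub ht, Real.rpow_two, two_mul, Real.rpow_add ht]
    field_simp
  rw [hdiv, h₁, h₂]
  ring

/-- The function `t ↦ t ^ (2 - γ) - t ^ (2 - 2γ)` has its strict global maximum on `(0, ∞)` at the
point `c` with `c ^ γ = 2 (γ - 1) / (γ - 2)`. -/
lemma rpow_sub_rpow_lt_of_ne {γ c t : ℝ} (hγ : 2 < γ) (hc : 0 < c)
    (hcγ : c ^ γ = 2 * (γ - 1) / (γ - 2)) (ht : 0 < t) (hne : t ≠ c) :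
    t ^ (2 - γ) - t ^ (2 - 2 * γ) < c ^ (2 - γ) - c ^ (2 - 2 * γ) := by
  have hγ₂ : 0 < γ - 2 := by linarith
  have hγ₁ : 0 < γ - 1 := by linarith
  obtain ⟨s, hs, rfl⟩ : ∃ s, 0 < s ∧ t = s * c := ⟨t / c, by positivity, by field_simp⟩
  have hs₁ : s ≠ 1 := fun h => hne (by rw [h, one_mul])
  set p : ℝ := (γ - 2) / (2 * (γ - 1)) with hp
  have hp₀ : 0 < p := by positivity
  have hp₁ : p < 1 := by rw [hp, div_lt_one (by positivity)]; linarith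
  have hcp : (c ^ γ)⁻¹ = p := by rw [hcγ, hp, inv_div]
  set y : ℝ := s ^ (2 - 2 * γ) with hy
  have hy₀ : 0 < y := Real.rpow_pos_of_pos hs _
  have hy₁ : y ≠ 1 := fun h =>
    hs₁ ((Real.rpow_left_inj hs.le zero_le_one (by linarith)).mp (h.trans (Real.one_rpow _).symm))
  have hyp : s ^ (2 - γ) = y ^ p := by
    rw [hy, ← Real.rpow_mul hs.le, hp]
    congr 1
    field_simp
    ring
  have hbern : y ^ p < 1 + p * (y - 1) := by
    have h := rpow_one_add_lt_one_add_mul_self (s := y - 1) (by linarith)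
      (sub_ne_zero.mpr hy₁) hp₀ hp₁
    simpa using h
  have hc₁ : c ^ (2 - γ) = c ^ 2 * p := by
    rw [Real.rpow_sub hc, Real.rpow_two, div_eq_mul_inv, hcp]
  have hc₂ : c ^ (2 - 2 * γ) = c ^ 2 * p ^ 2 := by
    rw [← hcp, Real.rpow_sub hc, Real.rpow_two, two_mul, Real.rpow_add hc]
    field_simp
  rw [Real.mul_rpow hs.le hc.le, Real.mul_rpow hs.le hc.le, hyp, ← hy, hc₁, hc₂]
  have hcp₀ : 0 < c ^ 2 * p := by positivity
  nlinarith [mul_lt_mul_of_pos_left hbern hcp₀]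

/-- Geometric Brownian motion with drift `μ < -σ²/2` and volatility `σ > 0`: with
`γ = 1 - 2μ/σ²`, the function `v(z) = z² · (x/z)^γ · (1 - (x/z)^γ)` attains its maximum
over `[x, ∞)` at the unique point `z* = (2μ/(μ + σ²/2))^{σ²/(σ² - 2μ)} · x`, and the
maximal value is
`x² · ((2μ/(μ + σ²/2))^{(σ² + 2μ)/(σ² - 2μ)} - (2μ/(μ + σ²/2))^{4μ/(σ² - 2μ)})`. -/
theorem gbm_variance_maximizer
    (σ μ : ℝ) (hσ : 0 < σ) (hμ : μ < -σ ^ 2 / 2) (x : ℝ) (hx : 0 < x) :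
    x ≤ (2 * μ / (μ + σ ^ 2 / 2)) ^ (σ ^ 2 / (σ ^ 2 - 2 * μ)) * x ∧
    (∀ z ∈ Set.Ici x,
      z ^ 2 * (x / z) ^ (1 - 2 * μ / σ ^ 2) * (1 - (x / z) ^ (1 - 2 * μ / σ ^ 2)) ≤
        ((2 * μ / (μ + σ ^ 2 / 2)) ^ (σ ^ 2 / (σ ^ 2 - 2 * μ)) * x) ^ 2 *
          (x / ((2 * μ / (μ + σ ^ 2 / 2)) ^ (σ ^ 2 / (σ ^ 2 - 2 * μ)) * x)) ^
            (1 - 2 * μ / σ ^ 2) *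
          (1 - (x / ((2 * μ / (μ + σ ^ 2 / 2)) ^ (σ ^ 2 / (σ ^ 2 - 2 * μ)) * x)) ^
            (1 - 2 * μ / σ ^ 2))) ∧
    (∀ z ∈ Set.Ici x,
      (∀ w ∈ Set.Ici x,
        w ^ 2 * (x / w) ^ (1 - 2 * μ / σ ^ 2) * (1 - (x / w) ^ (1 - 2 * μ / σ ^ 2)) ≤
          z ^ 2 * (x / z) ^ (1 - 2 * μ / σ ^ 2) * (1 - (x / z) ^ (1 - 2 * μ / σ ^ 2))) →
      z = (2 * μ / (μ + σ ^ 2 / 2)) ^ (σ ^ 2 / (σ ^ 2 - 2 * μ)) * x) ∧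
    ((2 * μ / (μ + σ ^ 2 / 2)) ^ (σ ^ 2 / (σ ^ 2 - 2 * μ)) * x) ^ 2 *
        (x / ((2 * μ / (μ + σ ^ 2 / 2)) ^ (σ ^ 2 / (σ ^ 2 - 2 * μ)) * x)) ^
          (1 - 2 * μ / σ ^ 2) *
        (1 - (x / ((2 * μ / (μ + σ ^ 2 / 2)) ^ (σ ^ 2 / (σ ^ 2 - 2 * μ)) * x)) ^
          (1 - 2 * μ / σ ^ 2)) =
      x ^ 2 * ((2 * μ / (μ + σ ^ 2 / 2)) ^ ((σ ^ 2 + 2 * μ) / (σ ^ 2 - 2 * μ)) -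
        (2 * μ / (μ + σ ^ 2 / 2)) ^ (4 * μ / (σ ^ 2 - 2 * μ))) := by
  have hσ₂ : 0 < σ ^ 2 := by positivity
  have hden : μ + σ ^ 2 / 2 < 0 := by linarith
  have hdiff : 0 < σ ^ 2 - 2 * μ := by linarith
  set γ : ℝ := 1 - 2 * μ / σ ^ 2 with hγ
  set K : ℝ := 2 * μ / (μ + σ ^ 2 / 2) with hK
  have hγσ : γ * σ ^ 2 = σ ^ 2 - 2 * μ := by rw [hγ]; field_simp
  have hγ₂ : 2 < γ := by nlinarith
  have hKγ : K = 2 * (γ - 1) / (γ - 2) := by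
    rw [hK, div_eq_div_iff hden.ne (by linarith), hγ]
    field_simp
    ring
  have hK₁ : 1 < K := by rw [hKγ, one_lt_div (by linarith)]; linarith
  have hK₀ : 0 < K := by linarith
  have hexp : σ ^ 2 / (σ ^ 2 - 2 * μ) = γ⁻¹ := by
    rw [← hγσ]
    field_simp
  set c : ℝ := K ^ (σ ^ 2 / (σ ^ 2 - 2 * μ)) with hc
  have hc₁ : 1 ≤ c := Real.one_le_rpow hK₁.le (by positivity)
  have hc₀ : 0 < c := by linarith
  have hcγ : c ^ γ = 2 * (γ - 1) / (γ - 2) := by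
    rw [hc, hexp, Real.rpow_inv_rpow hK₀.le (by linarith), hKγ]
  have hlt : ∀ z ∈ Set.Ici x, z ≠ c * x →
      z ^ 2 * (x / z) ^ γ * (1 - (x / z) ^ γ) <
        (c * x) ^ 2 * (x / (c * x)) ^ γ * (1 - (x / (c * x)) ^ γ) := by
    intro z hz hne
    have hz₀ : 0 < z := hx.trans_le hz
    obtain ⟨t, ht, rfl⟩ : ∃ t, 0 < t ∧ z = t * x := ⟨z / x, by positivity, by field_simp⟩
    rw [sq_mul_rpow_mul_one_sub_rpow γ hx ht, sq_mul_rpow_mul_one_sub_rpow γ hx hc₀]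
    have htc : t ≠ c := fun h => hne (by rw [h])
    exact mul_lt_mul_of_pos_left (rpow_sub_rpow_lt_of_ne hγ₂ hc₀ hcγ ht htc) (by positivity)
  have hmem : x ≤ c * x := le_mul_of_one_le_left hx.le hc₁
  refine ⟨hmem, fun z hz => ?_, fun z hz hmax => ?_, ?_⟩
  · rcases eq_or_ne z (c * x) with rfl | hne
    · exact le_rfl
    · exact (hlt z hz hne).le
  · by_contra hne
    exact (hlt z hz hne).not_ge (hmax (c * x) hmem)
  · rw [sq_mul_rpow_mul_one_sub_rpow γ hx hc₀, hc, ← Real.rpow_mul hK₀.le,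
      ← Real.rpow_mul hK₀.le]
    congr 3
    · rw [hγ]
      field_simp
      ring
    · rw [hγ]
      field_simp
      ring
end

section
/- Fix x, N, ĉ, M with 0 < x ≤ N < β and 0 ≤ ĉ < M, and define f(z,c) = ((z² - 2cz)/S(z))·S(x) + c² for z ∈ [x,N] and c ∈ [ĉ,M]. Then sup over Borel probability measures ν on [x,N] of inf_{c ∈ [ĉ,M]} ∫ f(z,c) dν(z) equals inf_{c ∈ [ĉ,M]} sup_{z ∈ [x,N]} f(z,c). Moreover, there exist z₁, z₂ ∈ [x,N], p ∈ [0,1] and c* ∈ [ĉ,M] such that the two-atom measure ν* = p·δ_{z₁} + (1 - p)·δ_{z₂} and the point c* are optimal: inf_{c ∈ [ĉ,M]} ∫ f(z,c) dν*(z) = sup_{z ∈ [x,N]} f(z,c*) = the common value above. -/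
open MeasureTheory

/-- If `v` is attained or exceeded by `a - 2cb + c²` at some point for every `c` slightly to the
right of `c₀`, but nowhere exceeded at `c₀`, then some point attains `v` at `c₀` with
nonpositive `b - c₀`. -/
lemma exists_eq_and_le_of_forall_exists_ge {T : Type*} [PseudoMetricSpace T] [CompactSpace T]
    {a b : T → ℝ} (ha : Continuous a) (hb : Continuous b) {c₀ M v : ℝ} (hM : c₀ < M)
    (hle : ∀ z, a z - 2 * c₀ * b z + c₀ ^ 2 ≤ v)
    (hge : ∀ c, c₀ < c → c ≤ M → ∃ z, v ≤ a z - 2 * c * b z + c ^ 2) :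
    ∃ z, a z - 2 * c₀ * b z + c₀ ^ 2 = v ∧ b z ≤ c₀ := by
  let u : ℕ → ℝ := fun n => c₀ + (M - c₀) * (1 / ((n : ℝ) + 1))
  have hu : Filter.Tendsto u Filter.atTop (nhds c₀) := by
    simpa [u] using (tendsto_one_div_add_atTop_nhds_zero_nat.const_mul (M - c₀)).const_add c₀
  have hu_gt (n : ℕ) : c₀ < u n := by
    have : 0 < (M - c₀) * (1 / ((n : ℝ) + 1)) := mul_pos (sub_pos.2 hM) (by positivity)
    simpa [u] using this
  have hu_le (n : ℕ) : u n ≤ M := by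
    have h1 : 1 / ((n : ℝ) + 1) ≤ 1 := by
      rw [div_le_one (by positivity)]
      linarith [n.cast_nonneg (α := ℝ)]
    have := mul_le_mul_of_nonneg_left h1 (sub_pos.2 hM).le
    simp only [u]
    linarith
  choose z hz using fun n => hge (u n) (hu_gt n) (hu_le n)
  have hbz (n : ℕ) : b (z n) ≤ (u n + c₀) / 2 := by
    have hpos := sub_pos.2 (hu_gt n)
    have h : 0 ≤ (u n - c₀) * (u n + c₀ - 2 * b (z n)) := by
      nlinarith [hz n, hle (z n)]
    linarith [nonneg_of_mul_nonneg_right h hpos]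
  obtain ⟨w, -, φ, hφ, hw⟩ := isCompact_univ.tendsto_subseq (x := z) fun _ => Set.mem_univ _
  have hau := (ha.tendsto w).comp hw
  have hbu := (hb.tendsto w).comp hw
  have huφ := hu.comp hφ.tendsto_atTop
  refine ⟨w, le_antisymm (hle w) ?_, ?_⟩
  · exact ge_of_tendsto' ((hau.sub ((huφ.const_mul 2).mul hbu)).add (huφ.pow 2))
      fun n => hz (φ n)
  · have h := le_of_tendsto_of_tendsto' hbu ((huφ.add_const c₀).div_const 2) fun n => hbz (φ n)
    linarith

/-- The game with payoff `a z - 2 c b z + c²` has a saddle point in which the maximizer mixes at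
most two points. -/
lemma exists_two_point_saddle {T : Type*} [PseudoMetricSpace T] [CompactSpace T] [Nonempty T]
    {a b : T → ℝ} (ha : Continuous a) (hb : Continuous b) {m M : ℝ} (hmM : m < M) :
    ∃ v, ∃ c₀ ∈ Set.Icc m M, ∃ z₁ z₂, ∃ p ∈ Set.Icc (0 : ℝ) 1,
      (∀ z, a z - 2 * c₀ * b z + c₀ ^ 2 ≤ v) ∧
      ∀ c ∈ Set.Icc m M, v ≤ p * (a z₁ - 2 * c * b z₁ + c ^ 2) +
        (1 - p) * (a z₂ - 2 * c * b z₂ + c ^ 2) := by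
  let F : ℝ → T → ℝ := fun c z => a z - 2 * c * b z + c ^ 2
  have hF : Continuous (fun q : ℝ × T => F q.1 q.2) := by
    simp only [F]
    fun_prop
  have hg : Continuous fun c => sSup (F c '' Set.univ) := isCompact_univ.continuous_sSup hF
  obtain ⟨c₀, hc₀, hmin⟩ := (isCompact_Icc (a := m) (b := M)).exists_isMinOn
    (Set.nonempty_Icc.2 hmM.le) hg.continuousOn
  have hFc (c : ℝ) : Continuous (F c) := hF.comp (Continuous.prodMk_right c)
  set v := sSup (F c₀ '' Set.univ)
  have hle (z : T) : F c₀ z ≤ v :=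
    le_csSup (isCompact_univ.image (hFc c₀)).bddAbove (Set.mem_image_of_mem _ (Set.mem_univ z))
  have hge (c : ℝ) (hc : c ∈ Set.Icc m M) : ∃ z, v ≤ F c z := by
    obtain ⟨z, -, hz⟩ := isCompact_univ.exists_sSup_image_eq Set.univ_nonempty (hFc c).continuousOn
    exact ⟨z, hz ▸ hmin hc⟩
  have hright (h : c₀ < M) : ∃ z, F c₀ z = v ∧ b z ≤ c₀ :=
    exists_eq_and_le_of_forall_exists_ge ha hb h hle
      fun c h1 h2 => hge c ⟨hc₀.1.trans h1.le, h2⟩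
  have hleft (h : m < c₀) : ∃ z, F c₀ z = v ∧ c₀ ≤ b z := by
    obtain ⟨z, hz, hbz⟩ := exists_eq_and_le_of_forall_exists_ge (b := fun z => -b z) (c₀ := -c₀)
      (M := -m) (v := v) ha hb.neg (neg_lt_neg h) (fun z => by linear_combination hle z) fun c h1 h2 => by
        obtain ⟨z, hz⟩ := hge (-c) ⟨by linarith, by linarith [hc₀.2]⟩
        exact ⟨z, by linear_combination hz⟩
    exact ⟨z, by linear_combination hz, neg_le_neg_iff.1 hbz⟩
  obtain ⟨z₁, z₂, p, hp, h1, h2, hderiv⟩ : ∃ z₁ z₂, ∃ p ∈ Set.Icc (0 : ℝ) 1, F c₀ z₁ = v ∧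
      F c₀ z₂ = v ∧ ∀ c ∈ Set.Icc m M,
        0 ≤ (c₀ - (p * b z₁ + (1 - p) * b z₂)) * (c - c₀) := by
    rcases hc₀.1.eq_or_lt with rfl | hm
    · obtain ⟨z, hz, hbz⟩ := hright hmM
      refine ⟨z, z, 1, by simp, hz, hz, fun c hc => mul_nonneg ?_ (sub_nonneg.2 hc.1)⟩
      linarith
    obtain ⟨z₂, hz₂, hbz₂⟩ := hleft hm
    rcases hc₀.2.eq_or_lt with rfl | hM
    · refine ⟨z₂, z₂, 1, by simp, hz₂, hz₂, fun c hc => mul_nonneg_of_nonpos_of_nonpos ?_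
        (sub_nonpos.2 hc.2)⟩
      linarith
    obtain ⟨z₁, hz₁, hbz₁⟩ := hright hM
    obtain ⟨p, q, hp, hq, hpq, h⟩ := Icc_subset_segment (𝕜 := ℝ) ⟨hbz₁, hbz₂⟩
    obtain rfl : q = 1 - p := by linarith
    simp only [smul_eq_mul] at h
    exact ⟨z₁, z₂, p, ⟨hp, by linarith⟩, hz₁, hz₂, fun c _ => by simp [h]⟩
  refine ⟨v, c₀, hc₀, z₁, z₂, p, hp, hle, fun c hc => ?_⟩
  simp only [F] at h1 h2
  have := hderiv c hc
  have hexp : p * (a z₁ - 2 * c * b z₁ + c ^ 2) + (1 - p) * (a z₂ - 2 * c * b z₂ + c ^ 2) =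
      v + 2 * ((c₀ - (p * b z₁ + (1 - p) * b z₂)) * (c - c₀)) + (c - c₀) ^ 2 := by
    linear_combination p * h1 + (1 - p) * h2
  nlinarith [sq_nonneg (c - c₀)]

/-- Minimax theorem for the variance-stopping game with payoff
`f(z, c) = ((z² - 2cz)/S(z))·S(x) + c²` on the compact strategy sets `[x, N]` (mixed
strategies: Borel probability measures) and `[ĉ, M]` (pure strategies): the sup-inf equals
the inf-sup, and optimal strategies exist with the sup-player's optimal mixed strategy a
mixture of at most two Dirac measures. -/
theorem game_value_and_two_atom_optimal_strategy
    (β : EReal) (S : ℝ → ℝ)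
    (hScont : ContinuousOn S {z : ℝ | 0 < z ∧ (z : EReal) < β})
    (hSmono : StrictMonoOn S {z : ℝ | 0 < z ∧ (z : EReal) < β})
    (hSpos : ∀ z : ℝ, 0 < z → (z : EReal) < β → 0 < S z)
    (x N chat M : ℝ) (hx : 0 < x) (hxN : x ≤ N) (hNβ : (N : EReal) < β)
    (hchat : 0 ≤ chat) (hchatM : chat < M) :
    sSup {r : ℝ | ∃ ν : Measure ℝ, IsProbabilityMeasure ν ∧ ν (Set.Icc x N) = 1 ∧
        r = sInf ((fun c : ℝ => ∫ z, (((z ^ 2 - 2 * c * z) / S z) * S x + c ^ 2) ∂ν) ''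
          Set.Icc chat M)} =
      sInf ((fun c : ℝ =>
        sSup ((fun z : ℝ => ((z ^ 2 - 2 * c * z) / S z) * S x + c ^ 2) '' Set.Icc x N)) ''
          Set.Icc chat M) ∧
    ∃ z₁ ∈ Set.Icc x N, ∃ z₂ ∈ Set.Icc x N, ∃ p ∈ Set.Icc (0 : ℝ) 1, ∃ cs ∈ Set.Icc chat M,
      sInf ((fun c : ℝ => ∫ z, (((z ^ 2 - 2 * c * z) / S z) * S x + c ^ 2)
          ∂(ENNReal.ofReal p • Measure.dirac z₁ + ENNReal.ofReal (1 - p) • Measure.dirac z₂)) ''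
          Set.Icc chat M) =
        sInf ((fun c : ℝ =>
          sSup ((fun z : ℝ => ((z ^ 2 - 2 * c * z) / S z) * S x + c ^ 2) '' Set.Icc x N)) ''
            Set.Icc chat M) ∧
      sSup ((fun z : ℝ => ((z ^ 2 - 2 * cs * z) / S z) * S x + cs ^ 2) '' Set.Icc x N) =
        sInf ((fun c : ℝ =>
          sSup ((fun z : ℝ => ((z ^ 2 - 2 * c * z) / S z) * S x + c ^ 2) '' Set.Icc x N)) ''
            Set.Icc chat M) := by
  let K := Set.Icc x N
  let a : ℝ → ℝ := fun z => z ^ 2 / S z * S x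
  let b : ℝ → ℝ := fun z => z / S z * S x
  have hrw (z c : ℝ) : ((z ^ 2 - 2 * c * z) / S z) * S x + c ^ 2 =
      a z - 2 * c * b z + c ^ 2 := by
    simp only [a, b]
    ring
  simp only [hrw]
  have hKsub : K ⊆ {z : ℝ | 0 < z ∧ (z : EReal) < β} := fun z hz =>
    ⟨hx.trans_le hz.1, (EReal.coe_le_coe_iff.2 hz.2).trans_lt hNβ⟩
  have hS : ContinuousOn S K := hScont.mono hKsub
  have hS0 : ∀ z ∈ K, S z ≠ 0 := fun z hz => (hSpos z (hKsub hz).1 (hKsub hz).2).ne'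
  have ha : ContinuousOn a K := ((continuousOn_id.pow 2).div hS hS0).mul continuousOn_const
  have hb : ContinuousOn b K := (continuousOn_id.div hS hS0).mul continuousOn_const
  have hK : IsCompact K := isCompact_Icc
  have : CompactSpace K := isCompact_iff_compactSpace.1 hK
  have : Nonempty K := ⟨⟨x, le_rfl, hxN⟩⟩
  obtain ⟨v, cs, hcs, ⟨z₁, hz₁⟩, ⟨z₂, hz₂⟩, p, hp, hle, hge⟩ :=
    exists_two_point_saddle ha.domRestrict hb.domRestrict hchatM
  simp only [Set.domRestrict_apply, Subtype.forall] at hle hge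
  have hbdd (c : ℝ) : BddAbove ((fun z => a z - 2 * c * b z + c ^ 2) '' K) :=
    (hK.image_of_continuousOn
      ((ha.sub (continuousOn_const.mul hb)).add continuousOn_const)).bddAbove
  have hsup (c : ℝ) (hc : c ∈ Set.Icc chat M) :
      v ≤ sSup ((fun z => a z - 2 * c * b z + c ^ 2) '' K) := by
    have h1 := le_csSup (hbdd c) (Set.mem_image_of_mem _ hz₁)
    have h2 := le_csSup (hbdd c) (Set.mem_image_of_mem _ hz₂)
    have h1' := mul_le_mul_of_nonneg_left h1 hp.1
    have h2' := mul_le_mul_of_nonneg_left h2 (sub_nonneg.2 hp.2)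
    have := hge c hc
    linarith
  have hsup_cs : sSup ((fun z => a z - 2 * cs * b z + cs ^ 2) '' K) = v := by
    refine le_antisymm (csSup_le (Set.Nonempty.image _ ⟨x, le_rfl, hxN⟩) ?_) (hsup cs hcs)
    rintro _ ⟨z, hz, rfl⟩
    exact hle z hz
  have hval : sInf ((fun c => sSup ((fun z => a z - 2 * c * b z + c ^ 2) '' K)) ''
      Set.Icc chat M) = v := by
    refine IsLeast.csInf_eq ⟨⟨cs, hcs, hsup_cs⟩, ?_⟩
    rintro _ ⟨c, hc, rfl⟩
    exact hsup c hc
  have hupper (ν : Measure ℝ) (hν : IsProbabilityMeasure ν) (hνK : ν K = 1) :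
      sInf ((fun c => ∫ z, (a z - 2 * c * b z + c ^ 2) ∂ν) '' Set.Icc chat M) ≤ v := by
    have hmem : ∀ᵐ z ∂ν, z ∈ K := (mem_ae_iff_prob_eq_one measurableSet_Icc).2 hνK
    have hres : ν.restrict K = ν := Measure.restrict_eq_self_of_ae_mem hmem
    have hai : Integrable a ν := by
      have := ha.integrableOn_compact (μ := ν) hK
      rwa [IntegrableOn, hres] at this
    have hbi : Integrable b ν := by
      have := hb.integrableOn_compact (μ := ν) hK
      rwa [IntegrableOn, hres] at this
    have hint (c : ℝ) : Integrable (fun z => a z - 2 * c * b z + c ^ 2) ν :=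
      (hai.sub (hbi.const_mul (2 * c))).add (integrable_const _)
    have heq (c : ℝ) : ∫ z, (a z - 2 * c * b z + c ^ 2) ∂ν =
        (∫ z, a z ∂ν) - 2 * c * (∫ z, b z ∂ν) + c ^ 2 := by
      rw [integral_add (f := fun z => a z - 2 * c * b z) (hai.sub (hbi.const_mul (2 * c)))
          (integrable_const _),
        integral_sub hai (hbi.const_mul (2 * c)), integral_const_mul]
      simp
    have hbelow : BddBelow ((fun c => ∫ z, (a z - 2 * c * b z + c ^ 2) ∂ν) ''
        Set.Icc chat M) := by
      refine ⟨(∫ z, a z ∂ν) - (∫ z, b z ∂ν) ^ 2, ?_⟩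
      rintro _ ⟨c, -, rfl⟩
      simp only [heq]
      linarith [sq_nonneg (c - ∫ z, b z ∂ν)]
    refine (csInf_le hbelow (Set.mem_image_of_mem _ hcs)).trans ?_
    calc ∫ z, (a z - 2 * cs * b z + cs ^ 2) ∂ν ≤ ∫ _, v ∂ν :=
          integral_mono_ae (hint cs) (integrable_const v) (hmem.mono hle)
      _ = v := by simp
  set μ : Measure ℝ :=
    ENNReal.ofReal p • Measure.dirac z₁ + ENNReal.ofReal (1 - p) • Measure.dirac z₂ with hμ_def
  have hp' := sub_nonneg.2 hp.2
  have hsum : ENNReal.ofReal p + ENNReal.ofReal (1 - p) = 1 := by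
    rw [← ENNReal.ofReal_add hp.1 hp']
    simp
  have hμ : IsProbabilityMeasure μ := ⟨by simp [hμ_def, hsum]⟩
  have hμK : μ K = 1 := by
    simp only [hμ_def, Measure.add_apply, Measure.smul_apply, smul_eq_mul,
      Measure.dirac_apply_of_mem hz₁, Measure.dirac_apply_of_mem hz₂, mul_one, hsum]
  have hμint (f : ℝ → ℝ) : ∫ z, f z ∂μ = p * f z₁ + (1 - p) * f z₂ := by
    have hi (z : ℝ) (q : ℝ) : Integrable f (ENNReal.ofReal q • Measure.dirac z) :=
      (integrable_dirac (by simp)).smul_measure ENNReal.ofReal_ne_top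
    rw [hμ_def, integral_add_measure (hi _ _) (hi _ _), integral_smul_measure,
      integral_smul_measure, integral_dirac, integral_dirac, ENNReal.toReal_ofReal hp.1,
      ENNReal.toReal_ofReal hp', smul_eq_mul, smul_eq_mul]
  have hμval : sInf ((fun c => ∫ z, (a z - 2 * c * b z + c ^ 2) ∂μ) '' Set.Icc chat M) = v := by
    refine le_antisymm (hupper μ hμ hμK) (le_csInf (Set.Nonempty.image _ ⟨cs, hcs⟩) ?_)
    rintro _ ⟨c, hc, rfl⟩
    simp only [hμint]
    exact hge c hc
  refine ⟨?_, z₁, hz₁, z₂, hz₂, p, hp, cs, hcs, hμval.trans hval.symm, hsup_cs.trans hval.symm⟩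
  refine Eq.trans (IsGreatest.csSup_eq ⟨⟨μ, hμ, hμK, hμval.symm⟩, ?_⟩) hval.symm
  rintro _ ⟨ν, hν, hνK, rfl⟩
  exact hupper ν hν hνK
end
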